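/- arXiv:2110.05234 — 10 statements merged into one kernel-verified Lean document; each statement's English description precedes it below -/
import Mathlib

section
/- Let n ≥ 5 be an integer and let v : ℝ → ℝ be four times continuously differentiable, everywhere positive, and a solution of the Delaunay ODE on all of ℝ. Then the function t ↦ H(v'''(t), v''(t), v'(t), v(t)) is constant on ℝ, where H is the Hamiltonian energy. -/
/-- For `n ≥ 5` and a positive `C⁴` solution `v` of the Delaunay ODE on all
of `ℝ`, the Hamiltonian energy
`H(v''', v'', v', v) = -v'''·v' + (v'')²/2 + ((n²-4n+8)/4)·(v')² - (n²(n-4)²/32)·v²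
  + ((n-4)²(n²-4)/32)·v^(2n/(n-4))`
is constant along the solution. -/
theorem stmt_0 (n : ℕ) (hn : 5 ≤ n) (v : ℝ → ℝ)
    (hv : ContDiff ℝ 4 v) (hpos : ∀ t, 0 < v t)
    (hode : ∀ t : ℝ,
      iteratedDeriv 4 v t - (((n : ℝ)^2 - 4*(n : ℝ) + 8)/2) * iteratedDeriv 2 v t
        + ((n : ℝ)^2 * ((n : ℝ) - 4)^2 / 16) * v t
        - ((n : ℝ) * ((n : ℝ) - 4) * ((n : ℝ)^2 - 4) / 16)
            * (v t) ^ (((n : ℝ) + 4)/((n : ℝ) - 4)) = 0) :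
    ∀ s t : ℝ,
      (-(iteratedDeriv 3 v s) * deriv v s + (iteratedDeriv 2 v s)^2/2
        + (((n : ℝ)^2 - 4*(n : ℝ) + 8)/4) * (deriv v s)^2
        - ((n : ℝ)^2 * ((n : ℝ) - 4)^2 / 32) * (v s)^2
        + (((n : ℝ) - 4)^2 * ((n : ℝ)^2 - 4) / 32) * (v s) ^ (2*(n : ℝ)/((n : ℝ) - 4)))
      =
      (-(iteratedDeriv 3 v t) * deriv v t + (iteratedDeriv 2 v t)^2/2
        + (((n : ℝ)^2 - 4*(n : ℝ) + 8)/4) * (deriv v t)^2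
        - ((n : ℝ)^2 * ((n : ℝ) - 4)^2 / 32) * (v t)^2
        + (((n : ℝ) - 4)^2 * ((n : ℝ)^2 - 4) / 32) * (v t) ^ (2*(n : ℝ)/((n : ℝ) - 4))) := by
  have hd : ∀ k : ℕ, k < 4 → ∀ t, HasDerivAt (iteratedDeriv k v) (iteratedDeriv (k+1) v t) t := by
    intro k hk t
    rw [iteratedDeriv_succ]
    exact ((hv.differentiable_iteratedDeriv k (by exact_mod_cast hk)) t).hasDerivAt
  have h0 : ∀ t, HasDerivAt v (deriv v t) t := fun t => by
    simpa [iteratedDeriv_zero, iteratedDeriv_one] using hd 0 (by norm_num) t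
  have h1 : ∀ t, HasDerivAt (deriv v) (iteratedDeriv 2 v t) t := fun t => by
    simpa [iteratedDeriv_one] using hd 1 (by norm_num) t
  have h2 := hd 2 (by norm_num)
  have h3 := hd 3 (by norm_num)
  have hn4 : (n : ℝ) - 4 ≠ 0 := by
    have : (5 : ℝ) ≤ n := by exact_mod_cast hn
    linarith
  have he : 2*(n : ℝ)/((n : ℝ) - 4) - 1 = ((n : ℝ) + 4)/((n : ℝ) - 4) := by
    field_simp
    ring
  have key : ∀ t, HasDerivAt (fun t => -(iteratedDeriv 3 v t) * deriv v t + (iteratedDeriv 2 v t)^2/2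
        + (((n : ℝ)^2 - 4*(n : ℝ) + 8)/4) * (deriv v t)^2
        - ((n : ℝ)^2 * ((n : ℝ) - 4)^2 / 32) * (v t)^2
        + (((n : ℝ) - 4)^2 * ((n : ℝ)^2 - 4) / 32) * (v t) ^ (2*(n : ℝ)/((n : ℝ) - 4))) 0 t := by
    intro t
    have hp := (h0 t).rpow_const (p := 2*(n : ℝ)/((n : ℝ) - 4)) (Or.inl (hpos t).ne')
    rw [he] at hp
    have H := (((((h3 t).neg.mul (h1 t)).add (((h2 t).pow 2).div_const 2)).add
      (((h1 t).pow 2).const_mul (((n : ℝ)^2 - 4*(n : ℝ) + 8)/4))).sub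
      (((h0 t).pow 2).const_mul ((n : ℝ)^2 * ((n : ℝ) - 4)^2 / 32))).add
      (hp.const_mul (((n : ℝ) - 4)^2 * ((n : ℝ)^2 - 4) / 32))
    refine H.congr_deriv ?_
    have ho := hode t
    have hc : ((n : ℝ) - 4)^2 * (2*(n : ℝ)/((n : ℝ) - 4)) = 2 * n * (n - 4) := by
      field_simp
    simp only [Pi.neg_apply, Nat.reduceAdd, Nat.cast_ofNat, Nat.add_one_sub_one, pow_one]
    generalize v t ^ (((n : ℝ) + 4)/((n : ℝ) - 4)) = P at *
    generalize 2*(n : ℝ)/((n : ℝ) - 4) = q at *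
    linear_combination (-(deriv v t)) * ho + (((n : ℝ)^2 - 4) / 32 * deriv v t * P) * hc
  intro s t
  exact is_const_of_deriv_eq_zero (fun t => (key t).differentiableAt) (fun t => (key t).deriv) s t
end

section
/- Let n ≥ 5 be an integer. The spherical solution v(t) = (cosh t)^((4−n)/2) is positive and satisfies the Delaunay ODE at every t ∈ ℝ, i.e. v''''(t) − ((n²−4n+8)/2)·v''(t) + (n²(n−4)²/16)·v(t) = (n(n−4)(n²−4)/16)·v(t)^((n+4)/(n−4)) for all t. -/
lemma deriv_cosh_rpow (a : ℝ) :
    deriv (fun t : ℝ => Real.cosh t ^ a) = fun t => a * (Real.sinh t * Real.cosh t ^ (a - 1)) := by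
  funext t
  have h := (Real.hasDerivAt_cosh t).rpow_const (p := a) (Or.inl (Real.cosh_pos t).ne')
  rw [h.deriv]; ring

lemma hasDerivAt_two (a t : ℝ) :
    HasDerivAt (fun t : ℝ => a * (Real.sinh t * Real.cosh t ^ (a - 1)))
      (a ^ 2 * Real.cosh t ^ a - a * (a - 1) * Real.cosh t ^ (a - 2)) t := by
  have hc := Real.cosh_pos t
  have h := (Real.hasDerivAt_cosh t).rpow_const (p := a - 1) (Or.inl hc.ne')
  have h2 := ((Real.hasDerivAt_sinh t).mul h).const_mul a
  refine h2.congr_deriv ?_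
  have e1 : Real.cosh t ^ (a - 1) = Real.cosh t ^ (a - 2) * Real.cosh t := by
    rw [← Real.rpow_add_one hc.ne']; congr 1; ring
  have e2 : Real.cosh t ^ a = Real.cosh t ^ (a - 2) * Real.cosh t * Real.cosh t := by
    rw [← Real.rpow_add_one hc.ne', ← Real.rpow_add_one hc.ne']; congr 1; ring
  have e3 : Real.cosh t ^ (a - 1 - 1) = Real.cosh t ^ (a - 2) := by congr 1; ring
  rw [e3, e1, e2]
  have hs := Real.sinh_sq t
  linear_combination (a * (a - 1) * Real.cosh t ^ (a - 2)) * hs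

lemma deriv_two (a : ℝ) : deriv (deriv (fun t : ℝ => Real.cosh t ^ a)) =
    fun t => a ^ 2 * Real.cosh t ^ a - a * (a - 1) * Real.cosh t ^ (a - 2) := by
  rw [deriv_cosh_rpow]
  funext t
  exact (hasDerivAt_two a t).deriv

lemma deriv_four (a : ℝ) : deriv (deriv (deriv (deriv (fun t : ℝ => Real.cosh t ^ a)))) =
    fun t => a ^ 2 * (a ^ 2 * Real.cosh t ^ a - a * (a - 1) * Real.cosh t ^ (a - 2))
      - a * (a - 1) * ((a - 2) ^ 2 * Real.cosh t ^ (a - 2)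
        - (a - 2) * (a - 2 - 1) * Real.cosh t ^ (a - 2 - 2)) := by
  rw [deriv_two]
  have hd : ∀ b t : ℝ, HasDerivAt (fun t : ℝ => Real.cosh t ^ b)
      (b * (Real.sinh t * Real.cosh t ^ (b - 1))) t := fun b t =>
    ((Real.hasDerivAt_cosh t).rpow_const (p := b) (Or.inl (Real.cosh_pos t).ne')).congr_deriv
      (by ring)
  have h1 : deriv (fun t : ℝ => a ^ 2 * Real.cosh t ^ a - a * (a - 1) * Real.cosh t ^ (a - 2)) =
      fun t => a ^ 2 * (a * (Real.sinh t * Real.cosh t ^ (a - 1)))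
        - a * (a - 1) * ((a - 2) * (Real.sinh t * Real.cosh t ^ (a - 2 - 1))) := by
    funext t
    exact (((hd a t).const_mul (a ^ 2)).sub ((hd (a - 2) t).const_mul (a * (a - 1)))).deriv
  rw [h1]
  funext t
  exact (((hasDerivAt_two a t).const_mul (a ^ 2)).sub
    ((hasDerivAt_two (a - 2) t).const_mul (a * (a - 1)))).deriv


/-- For `n ≥ 5`, the spherical solution `v(t) = (cosh t)^((4-n)/2)` is
positive and solves the Delaunay ODE at every `t`. -/
theorem stmt_1 (n : ℕ) (hn : 5 ≤ n) (v : ℝ → ℝ)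
    (hv : ∀ t : ℝ, v t = (Real.cosh t) ^ (((4 : ℝ) - (n : ℝ))/2)) :
    (∀ t : ℝ, 0 < v t) ∧
    (∀ t : ℝ,
      iteratedDeriv 4 v t - (((n : ℝ)^2 - 4*(n : ℝ) + 8)/2) * iteratedDeriv 2 v t
        + ((n : ℝ)^2 * ((n : ℝ) - 4)^2 / 16) * v t
      = ((n : ℝ) * ((n : ℝ) - 4) * ((n : ℝ)^2 - 4) / 16)
          * (v t) ^ (((n : ℝ) + 4)/((n : ℝ) - 4))) := by
  have hn' : (5 : ℝ) ≤ n := by exact_mod_cast hn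
  obtain rfl : v = fun t => (Real.cosh t) ^ (((4 : ℝ) - (n : ℝ))/2) := funext hv
  refine ⟨fun t => Real.rpow_pos_of_pos (Real.cosh_pos t) _, fun t => ?_⟩
  obtain ⟨a, ha⟩ : ∃ a : ℝ, a = ((4 : ℝ) - (n : ℝ))/2 := ⟨_, rfl⟩
  have hna : (n : ℝ) = 4 - 2 * a := by rw [ha]; ring
  have ha0 : a ≠ 0 := by intro h; rw [h] at hna; linarith
  simp only [iteratedDeriv_succ, iteratedDeriv_zero, ← ha]
  rw [deriv_four, deriv_two, ← Real.rpow_mul (Real.cosh_pos t).le]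
  have he : a * (((n : ℝ) + 4)/((n : ℝ) - 4)) = a - 2 - 2 := by
    rw [hna]
    have : (4 - 2 * a - 4) ≠ 0 := by
      intro h; apply ha0; linarith
    field_simp
    ring
  rw [he, hna]
  ring_nf
end

section
/- Let n ≥ 5 be an integer and let v(t) = (cosh t)^((4−n)/2) be the spherical solution. Then the Hamiltonian energy of v vanishes identically: H(v'''(t), v''(t), v'(t), v(t)) = 0 for every t ∈ ℝ. -/
/-- For `n ≥ 5`, the Hamiltonian energy of the spherical solution
`v(t) = (cosh t)^((4-n)/2)` vanishes identically. -/
theorem stmt_2 (n : ℕ) (hn : 5 ≤ n) (v : ℝ → ℝ)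
    (hv : ∀ t : ℝ, v t = (Real.cosh t) ^ (((4 : ℝ) - (n : ℝ))/2)) :
    ∀ t : ℝ,
      -(iteratedDeriv 3 v t) * deriv v t + (iteratedDeriv 2 v t)^2/2
        + (((n : ℝ)^2 - 4*(n : ℝ) + 8)/4) * (deriv v t)^2
        - ((n : ℝ)^2 * ((n : ℝ) - 4)^2 / 32) * (v t)^2
        + (((n : ℝ) - 4)^2 * ((n : ℝ)^2 - 4) / 32) * (v t) ^ (2*(n : ℝ)/((n : ℝ) - 4))
      = 0 := by
  intro t
  set a : ℝ := ((4 : ℝ) - (n : ℝ))/2 with ha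
  have hn5 : (5 : ℝ) ≤ (n : ℝ) := by exact_mod_cast hn
  have hna : (n : ℝ) = 4 - 2 * a := by rw [ha]; ring
  have ha0 : a ≠ 0 := by
    intro h
    rw [h] at hna
    linarith
  have hT : ∀ x : ℝ, HasDerivAt (fun x => Real.sinh x / Real.cosh x)
      (1 - (Real.sinh x / Real.cosh x)^2) x := by
    intro x
    have hc := (Real.cosh_pos x).ne'
    refine ((Real.hasDerivAt_sinh x).div (Real.hasDerivAt_cosh x) hc).congr_deriv ?_
    field_simp
  have h1 : ∀ x : ℝ, HasDerivAt v (a * v x * (Real.sinh x / Real.cosh x)) x := by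
    intro x
    have hc := (Real.cosh_pos x).ne'
    have h := (Real.hasDerivAt_cosh x).rpow_const (p := a) (Or.inl hc)
    have hvf : v = fun x => Real.cosh x ^ a := funext hv
    rw [hvf]
    refine h.congr_deriv ?_
    rw [Real.rpow_sub_one hc]
    field_simp
  have d1 : deriv v = fun x => a * v x * (Real.sinh x / Real.cosh x) :=
    funext fun x => (h1 x).deriv
  have d2 : iteratedDeriv 2 v =
      fun x => v x * (a + (a^2 - a) * (Real.sinh x / Real.cosh x)^2) := by
    funext x
    rw [iteratedDeriv_succ, iteratedDeriv_one, d1]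
    refine ((((h1 x).const_mul a).mul (hT x)).congr_deriv ?_).deriv
    ring
  have d3 : iteratedDeriv 3 v t = v t * (a * (Real.sinh t / Real.cosh t) *
      (a + (a^2 - a) * (Real.sinh t / Real.cosh t)^2)
      + 2 * (a^2 - a) * (Real.sinh t / Real.cosh t) * (1 - (Real.sinh t / Real.cosh t)^2)) := by
    rw [iteratedDeriv_succ, d2]
    refine (((h1 t).mul ((((hT t).pow 2).const_mul (a^2 - a)).const_add a)).congr_deriv ?_).deriv
    simp only [Pi.pow_apply]
    ring
  have hcp := Real.cosh_pos t
  have hp : (v t) ^ (2*(n : ℝ)/((n : ℝ) - 4))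
      = (v t)^2 * (1 - (Real.sinh t / Real.cosh t)^2)^2 := by
    have e1 : 1 - (Real.sinh t / Real.cosh t)^2 = (Real.cosh t ^ 2)⁻¹ := by
      have := Real.cosh_sq t
      field_simp
      linarith
    have e2 : a * (2*(n : ℝ)/((n : ℝ) - 4)) = a + a - (4 : ℕ) := by
      rw [hna]
      have : (4 - 2 * a - 4) ≠ 0 := by
        intro h
        apply ha0
        linarith
      push_cast
      field_simp
      ring
    rw [e1, hv t, ← Real.rpow_mul hcp.le, e2, Real.rpow_sub hcp, Real.rpow_add hcp,
      Real.rpow_natCast]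
    field_simp
  rw [hp, d3, d2, d1, hna]
  ring
end

section
/- Let n ≥ 5 be an integer, A = (n²−4n+8)/2, B = n²(n−4)²/16. Let v : ℝ → ℝ be a four times continuously differentiable, positive, bounded solution of the Delaunay ODE which is symmetric about each of its critical points (i.e. whenever v'(t₀) = 0 one has v(t₀+s) = v(t₀−s) for all s ∈ ℝ), and suppose ε > 0 satisfies ε ≤ v(t) for all t. Let ω be a real number with B − (n(n+4)(n²−4)/16)·ε^(8/(n−4)) < ω, 0 ≤ ω, and ω < A²/4, and set λ = A/2 − (1/2)·√(A²−4ω) and μ = A/2 + (1/2)·√(A²−4ω). Then for every γ ∈ [λ, μ] and every t ∈ ℝ: if v'(t) > 0 then v'''(t) − γ·v'(t) < 0; if v'(t) < 0 then v'''(t) − γ·v'(t) > 0; and if v'(t) = 0 then v'''(t) − γ·v'(t) = 0. -/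
open Filter Topology Set

lemma aux_tendsto (f g : ℝ → ℝ) (h : ∀ t, HasDerivAt f (g t) t) (c : ℝ) (hc : 0 < c)
    (hg : ∀ᶠ t in atTop, c ≤ g t) : Tendsto f atTop atTop := by
  obtain ⟨T, hT⟩ := eventually_atTop.1 hg
  have hmono : MonotoneOn (fun t => f t - c * t) (Ici T) := by
    have hd : ∀ t, HasDerivAt (fun t => f t - c * t) (g t - c) t := fun t => by
      exact HasDerivAt.congr_deriv ((h t).sub ((hasDerivAt_id t).const_mul c)) (by simp)
    apply monotoneOn_of_deriv_nonneg (convex_Ici T)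
    · exact fun t _ => (hd t).continuousAt.continuousWithinAt
    · exact fun t _ => (hd t).differentiableAt.differentiableWithinAt
    · intro t ht
      rw [interior_Ici] at ht
      rw [(hd t).deriv]
      linarith [hT t (le_of_lt ht)]
  have h1 : Tendsto (fun t => c * t + (f T - c * T)) atTop atTop :=
    tendsto_atTop_add_const_right _ _ (tendsto_id.const_mul_atTop hc)
  apply tendsto_atTop_mono' _ _ h1
  filter_upwards [eventually_ge_atTop T] with t ht
  have := hmono (mem_Ici.2 le_rfl) (mem_Ici.2 ht) ht
  simp only at this
  linarith

lemma aux_strict (f g : ℝ → ℝ) (h : ∀ t, HasDerivAt f (g t) t) (a b : ℝ)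
    (hg : ∀ t ∈ Ioo a b, 0 < g t) (hab : a < b) : f a < f b := by
  obtain ⟨c, hc, he⟩ := exists_hasDerivAt_eq_slope f g hab
    (fun t _ => (h t).continuousAt.continuousWithinAt) (fun t _ => h t)
  have := hg c hc
  rw [he] at this
  have h2 : 0 < b - a := by linarith
  have := (div_pos_iff_of_pos_right h2).1 this
  linarith

/-- positivity of `z` on an interval -/
lemma aux_pos (z zp zpp : ℝ → ℝ) (k : ℝ) (a b : ℝ)
    (hz : ∀ t, HasDerivAt z (zp t) t) (hzp : ∀ t, HasDerivAt zp (zpp t) t)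
    (hq : ∀ t ∈ Ico a b, 0 < zpp t - k ^ 2 * z t)
    (h0 : 0 ≤ z a) (h1 : 0 ≤ zp a) (hk : 0 ≤ k) :
    ∀ t, a < t → t ≤ b → 0 < z t := by
  have hE : ∀ (c t : ℝ), HasDerivAt (fun t => Real.exp (c * t)) (Real.exp (c * t) * c) t := by
    intro c t
    simpa using ((hasDerivAt_id t).const_mul c).exp
  have hp : ∀ t, a < t → t ≤ b → 0 < zp t + k * z t := by
    intro t hat htb
    have := aux_strict (fun t => Real.exp (-k * t) * (zp t + k * z t))
      (fun t => Real.exp (-k * t) * (-k) * (zp t + k * z t)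
        + Real.exp (-k * t) * (zpp t + k * zp t))
      (fun t => (hE (-k) t).mul ((hzp t).add ((hz t).const_mul k))) a t
      (by
        intro s hs
        have h := mul_pos (Real.exp_pos (-k * s)) (hq s ⟨hs.1.le, hs.2.trans_le htb⟩)
        nlinarith) hat
    have h3 : 0 ≤ Real.exp (-k * a) * (zp a + k * z a) := by positivity
    exact (mul_pos_iff_of_pos_left (Real.exp_pos _)).1 (h3.trans_lt this)
  intro t hat htb
  have := aux_strict (fun t => Real.exp (k * t) * z t)
      (fun t => Real.exp (k * t) * k * z t + Real.exp (k * t) * zp t)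
      (fun t => (hE k t).mul (hz t)) a t
      (by
        intro s hs
        have h := mul_pos (Real.exp_pos (k * s)) (hp s hs.1 (hs.2.le.trans htb))
        nlinarith) hat
  have h3 : 0 ≤ Real.exp (k * a) * z a := by positivity
  exact (mul_pos_iff_of_pos_left (Real.exp_pos _)).1 (h3.trans_lt this)

lemma aux_fwd (V w w1 w2 z zp zpp q : ℝ → ℝ) (M la k : ℝ) (hla : 0 ≤ la) (hk : 0 ≤ k)
    (hV : ∀ t, HasDerivAt V (w t) t) (hw : ∀ t, HasDerivAt w (w1 t) t)
    (hw1 : ∀ t, HasDerivAt w1 (w2 t) t) (hzd : ∀ t, z t = w2 t - la * w t)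
    (hz : ∀ t, HasDerivAt z (zp t) t) (hzp : ∀ t, HasDerivAt zp (zpp t) t)
    (hqp : ∀ t, 0 < q t) (heq : ∀ t, zpp t - k ^ 2 * z t = q t * w t)
    (hM : ∀ t, V t ≤ M) (hzero : ∀ t, w t = 0 → w2 t = 0)
    (t1 : ℝ) (h1 : 0 < w t1) (h2 : 0 ≤ z t1) (h3 : 0 ≤ zp t1) : False := by
  have hwc : Continuous w := continuous_iff_continuousAt.2 fun t => (hw t).continuousAt
  have hivt : ∀ s, t1 ≤ s → w s ≤ 0 → ∃ r ∈ Icc t1 s, w r = 0 := fun s hs h0 =>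
    intermediate_value_Icc' hs hwc.continuousOn ⟨h0, h1.le⟩
  have hpos : ∀ t, t1 ≤ t → 0 < w t := by
    by_contra! hcon
    obtain ⟨s, hs, hws⟩ := hcon
    obtain ⟨r, hr, hwr⟩ := hivt s hs hws
    have hcl : IsClosed (Ici t1 ∩ w ⁻¹' {0}) := isClosed_Ici.inter (isClosed_singleton.preimage hwc)
    have hbb : BddBelow (Ici t1 ∩ w ⁻¹' {0}) := ⟨t1, fun x hx => hx.1⟩
    have hmem := hcl.csInf_mem ⟨r, hr.1, hwr⟩ hbb
    set b := sInf (Ici t1 ∩ w ⁻¹' {0}) with hb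
    have hb1 : t1 ≤ b := hmem.1
    have hb0 : w b = 0 := hmem.2
    have hbt : t1 < b := lt_of_le_of_ne hb1 (fun h => by rw [h] at h1; linarith)
    have hpo : ∀ t ∈ Ico t1 b, 0 < w t := by
      intro t ht
      by_contra! hh
      obtain ⟨r, hr, hwr⟩ := hivt t ht.1 hh
      have : b ≤ r := csInf_le hbb ⟨hr.1, hwr⟩
      linarith [hr.2, ht.2]
    have := aux_pos z zp zpp k t1 b hz hzp
      (fun t ht => by rw [heq]; exact mul_pos (hqp t) (hpo t ht)) h2 h3 hk b hbt le_rfl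
    rw [hzd, hb0, hzero b hb0] at this
    simp at this
  have hzpos : ∀ t, t1 < t → 0 < z t := fun t ht =>
    aux_pos z zp zpp k t1 t hz hzp
      (fun t ht => by rw [heq]; exact mul_pos (hqp t) (hpos t ht.1)) h2 h3 hk t ht le_rfl
  have hzpp : ∀ t, t1 < t → 0 < zpp t := fun t ht => by
    have := heq t
    have h5 := mul_pos (hqp t) (hpos t ht.le)
    have h6 := mul_nonneg (sq_nonneg k) (hzpos t ht).le
    linarith
  have hc : 0 < zp (t1 + 1) := h3.trans_lt
    (aux_strict zp zpp hzp t1 (t1+1) (fun t ht => hzpp t ht.1) (by linarith))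
  have hzpg : ∀ᶠ t in atTop, zp (t1 + 1) ≤ zp t := by
    filter_upwards [eventually_gt_atTop (t1+1)] with t ht
    exact (aux_strict zp zpp hzp (t1+1) t (fun s hs => hzpp s (by linarith [hs.1])) ht).le
  have T0 := aux_tendsto z zp hz _ hc hzpg
  have T1 : Tendsto w2 atTop atTop := by
    apply tendsto_atTop_mono' _ _ T0
    filter_upwards [eventually_ge_atTop t1] with t ht
    have := mul_nonneg hla (hpos t ht).le
    linarith [hzd t]
  have T2 := aux_tendsto w1 w2 hw1 1 one_pos (T1.eventually_ge_atTop 1)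
  have T3 := aux_tendsto w w1 hw 1 one_pos (T2.eventually_ge_atTop 1)
  have T4 := aux_tendsto V w hV 1 one_pos (T3.eventually_ge_atTop 1)
  obtain ⟨t, ht⟩ := (T4.eventually_gt_atTop M).exists
  linarith [hM t]

lemma aux_main (V w w1 w2 z zp zpp q : ℝ → ℝ) (M N la k : ℝ) (hla : 0 ≤ la) (hk : 0 ≤ k)
    (hV : ∀ t, HasDerivAt V (w t) t) (hw : ∀ t, HasDerivAt w (w1 t) t)
    (hw1 : ∀ t, HasDerivAt w1 (w2 t) t) (hzd : ∀ t, z t = w2 t - la * w t)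
    (hz : ∀ t, HasDerivAt z (zp t) t) (hzp : ∀ t, HasDerivAt zp (zpp t) t)
    (hqp : ∀ t, 0 < q t) (heq : ∀ t, zpp t - k ^ 2 * z t = q t * w t)
    (hM : ∀ t, V t ≤ M) (hN : ∀ t, N ≤ V t) (hzero : ∀ t, w t = 0 → w2 t = 0)
    (t1 : ℝ) (h1 : 0 < w t1) : z t1 < 0 := by
  by_contra! h2
  rcases le_or_gt 0 (zp t1) with h3 | h3
  · exact aux_fwd V w w1 w2 z zp zpp q M la k hla hk hV hw hw1 hzd hz hzp hqp heq hM hzero t1 h1 h2 h3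
  · have hr : ∀ (f g : ℝ → ℝ), (∀ t, HasDerivAt f (g t) t) →
        ∀ t, HasDerivAt (fun t => f (-t)) (-g (-t)) t := by
      intro f g h t
      exact HasDerivAt.congr_deriv ((h (-t)).scomp t (hasDerivAt_neg t)) (by simp)
    have hr' : ∀ (f g : ℝ → ℝ), (∀ t, HasDerivAt f (g t) t) →
        ∀ t, HasDerivAt (fun t => -f (-t)) (g (-t)) t := by
      intro f g h t
      exact HasDerivAt.congr_deriv ((hr f g h t).neg) (by simp)
    exact aux_fwd (fun t => -V (-t)) (fun t => w (-t)) (fun t => -w1 (-t)) (fun t => w2 (-t))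
      (fun t => z (-t)) (fun t => -zp (-t)) (fun t => zpp (-t)) (fun t => q (-t)) (-N) la k hla hk
      (hr' _ _ hV) (hr _ _ hw) (hr' _ _ hw1) (fun t => hzd _) (hr _ _ hz) (hr' _ _ hzp)
      (fun t => hqp _) (fun t => heq _) (fun t => neg_le_neg (hN _)) (fun t => hzero _)
      (-t1) (by simpa using h1) (by simpa using h2) (by simpa using h3.le)


/-- Sign of `v''' - γ·v'` for a positive, bounded, symmetric Delaunay solution
bounded below by `ε`, with `γ ∈ [λ, μ]` where `λ, μ` are the roots determined by `ω`. -/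
theorem stmt_5 (n : ℕ) (hn : 5 ≤ n)
    (A B : ℝ) (hA : A = ((n : ℝ)^2 - 4*(n : ℝ) + 8)/2)
    (hB : B = (n : ℝ)^2 * ((n : ℝ) - 4)^2 / 16)
    (v : ℝ → ℝ) (hv : ContDiff ℝ 4 v) (hpos : ∀ t, 0 < v t)
    (hbdd : ∃ M : ℝ, ∀ t, v t ≤ M)
    (hode : ∀ t : ℝ,
      iteratedDeriv 4 v t - A * iteratedDeriv 2 v t + B * v t
        - ((n : ℝ) * ((n : ℝ) - 4) * ((n : ℝ)^2 - 4) / 16)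
            * (v t) ^ (((n : ℝ) + 4)/((n : ℝ) - 4)) = 0)
    (hsym : ∀ t₀ : ℝ, deriv v t₀ = 0 → ∀ s : ℝ, v (t₀ + s) = v (t₀ - s))
    (ε : ℝ) (hε : 0 < ε) (hεv : ∀ t, ε ≤ v t)
    (om : ℝ)
    (hom1 : B - ((n : ℝ) * ((n : ℝ) + 4) * ((n : ℝ)^2 - 4) / 16) * ε ^ ((8 : ℝ)/((n : ℝ) - 4)) < om)
    (hom0 : 0 ≤ om) (hom2 : om < A^2/4)
    (lam mu : ℝ) (hlam : lam = A/2 - Real.sqrt (A^2 - 4*om)/2)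
    (hmu : mu = A/2 + Real.sqrt (A^2 - 4*om)/2) :
    ∀ γ ∈ Set.Icc lam mu, ∀ t : ℝ,
      (0 < deriv v t → iteratedDeriv 3 v t - γ * deriv v t < 0) ∧
      (deriv v t < 0 → 0 < iteratedDeriv 3 v t - γ * deriv v t) ∧
      (deriv v t = 0 → iteratedDeriv 3 v t - γ * deriv v t = 0) := by

  have hn' : (5:ℝ) ≤ n := by exact_mod_cast hn
  have hn4 : (n:ℝ) - 4 ≠ 0 := by linarith
  obtain ⟨M, hM⟩ := hbdd
  have hA0 : 0 < A := by rw [hA]; nlinarith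
  have hD : 0 ≤ A^2 - 4*om := by linarith
  have hs := Real.sq_sqrt hD
  have hs0 := Real.sqrt_nonneg (A^2 - 4*om)
  have hsum : lam + mu = A := by rw [hlam, hmu]; ring
  have hprod : lam * mu = om := by rw [hlam, hmu]; nlinarith
  have hmu0 : 0 < mu := by rw [hmu]; linarith
  have hlam0 : 0 ≤ lam := by
    by_contra! h
    nlinarith
  have hk : (Real.sqrt mu)^2 = mu := Real.sq_sqrt hmu0.le
  have hd : ∀ k : ℕ, k < 4 → ∀ t, HasDerivAt (iteratedDeriv k v) (iteratedDeriv (k+1) v t) t := by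
    intro k hk t
    rw [iteratedDeriv_succ]
    exact ((hv.differentiable_iteratedDeriv k (by exact_mod_cast hk)) t).hasDerivAt
  have hv0 : ∀ t, HasDerivAt v (deriv v t) t := fun t => by
    have := hd 0 (by norm_num) t
    simpa using this
  have hv1 : ∀ t, HasDerivAt (deriv v) (iteratedDeriv 2 v t) t := fun t => by
    have := hd 1 (by norm_num) t
    simpa using this
  have hv2 := hd 2 (by norm_num)
  have hv3 := hd 3 (by norm_num)
  norm_num at hv2 hv3
  set C' : ℝ := (n : ℝ) * ((n : ℝ) + 4) * ((n : ℝ)^2 - 4) / 16 with hC'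
  have hC'0 : 0 < C' := by
    have : 0 < (n:ℝ)^2 - 4 := by nlinarith
    positivity
  have hv4 : ∀ t, HasDerivAt (iteratedDeriv 4 v)
      (A * iteratedDeriv 3 v t - (B - C' * v t ^ ((8:ℝ)/((n:ℝ)-4))) * deriv v t) t := by
    intro t
    have e : iteratedDeriv 4 v = fun t => A * iteratedDeriv 2 v t - B * v t
        + ((n : ℝ) * ((n : ℝ) - 4) * ((n : ℝ)^2 - 4) / 16)
            * (v t) ^ (((n : ℝ) + 4)/((n : ℝ) - 4)) := by
      funext t; linarith [hode t]
    rw [e]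
    have h := (((hv2 t).const_mul A).sub ((hv0 t).const_mul B)).add
      (((hv0 t).rpow_const (p := ((n : ℝ) + 4)/((n : ℝ) - 4)) (Or.inl (hpos t).ne')).const_mul
        ((n : ℝ) * ((n : ℝ) - 4) * ((n : ℝ)^2 - 4) / 16))
    refine h.congr_deriv ?_
    have e2 : ((n : ℝ) + 4)/((n : ℝ) - 4) - 1 = (8:ℝ)/((n:ℝ)-4) := by field_simp; ring
    rw [e2, hC']
    field_simp
    ring
  set q : ℝ → ℝ := fun t => om - B + C' * v t ^ ((8:ℝ)/((n:ℝ)-4)) with hq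
  have hq0 : ∀ t, 0 < q t := by
    intro t
    have : ε ^ ((8:ℝ)/((n:ℝ)-4)) ≤ v t ^ ((8:ℝ)/((n:ℝ)-4)) :=
      Real.rpow_le_rpow hε.le (hεv t) (div_nonneg (by norm_num) (by linarith))
    have := mul_le_mul_of_nonneg_left this hC'0.le
    simp only [hq]
    linarith
  have hzero : ∀ t, deriv v t = 0 → iteratedDeriv 3 v t = 0 := by
    intro t0 h0
    have hs := hsym t0 h0
    have hp : ∀ (f g : ℝ → ℝ), (∀ t, HasDerivAt f (g t) t) →
        ∀ s, HasDerivAt (fun s => f (t0 + s)) (g (t0 + s)) s := fun f g h s => by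
      exact HasDerivAt.congr_deriv ((h (t0 + s)).scomp s ((hasDerivAt_id s).const_add t0)) (by simp)
    have hm : ∀ (f g : ℝ → ℝ), (∀ t, HasDerivAt f (g t) t) →
        ∀ s, HasDerivAt (fun s => f (t0 - s)) (-g (t0 - s)) s := fun f g h s => by
      exact HasDerivAt.congr_deriv ((h (t0 - s)).scomp s ((hasDerivAt_id s).const_sub t0)) (by simp)
    have s1 : ∀ s, deriv v (t0 + s) = -deriv v (t0 - s) := fun s =>
      (hp _ _ hv0 s).unique ((funext hs : (fun s => v (t0 + s)) = _) ▸ hm _ _ hv0 s)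
    have s2 : ∀ s, iteratedDeriv 2 v (t0 + s) = iteratedDeriv 2 v (t0 - s) := fun s => by
      have h := (hm _ _ hv1 s).neg
      have h' := hp _ _ hv1 s
      rw [(funext s1 : (fun s => deriv v (t0 + s)) = _)] at h'
      simpa using h'.unique h
    have s3 : ∀ s, iteratedDeriv 3 v (t0 + s) = -iteratedDeriv 3 v (t0 - s) := fun s => by
      have h := hm _ _ hv2 s
      have h' := hp _ _ hv2 s
      rw [(funext s2 : (fun s => iteratedDeriv 2 v (t0 + s)) = _)] at h'
      exact h'.unique h
    have := s3 0
    simp only [add_zero, sub_zero] at this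
    linarith
  have heq : ∀ t, (A * iteratedDeriv 3 v t - (B - C' * v t ^ ((8:ℝ)/((n:ℝ)-4))) * deriv v t
      - lam * iteratedDeriv 3 v t) - (Real.sqrt mu)^2 * (iteratedDeriv 3 v t - lam * deriv v t)
      = q t * deriv v t := by
    intro t
    rw [hk, ← hsum]
    simp only [hq]
    rw [← hprod]
    ring
  intro γ hγ t
  refine ⟨fun h => ?_, fun h => ?_, fun h => ?_⟩
  · have := aux_main v (deriv v) (iteratedDeriv 2 v) (iteratedDeriv 3 v)
      (fun t => iteratedDeriv 3 v t - lam * deriv v t)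
      (fun t => iteratedDeriv 4 v t - lam * iteratedDeriv 2 v t)
      _ q M 0 lam (Real.sqrt mu) hlam0 (Real.sqrt_nonneg _) hv0 hv1 hv2 (fun t => rfl)
      (fun t => (hv3 t).sub ((hv1 t).const_mul lam))
      (fun t => (hv4 t).sub ((hv2 t).const_mul lam)) hq0 heq hM (fun t => (hpos t).le) hzero t h
    have h2 := mul_le_mul_of_nonneg_right hγ.1 h.le
    linarith
  · have := aux_main (fun t => -v t) (fun t => -deriv v t) (fun t => -iteratedDeriv 2 v t)
      (fun t => -iteratedDeriv 3 v t)
      (fun t => -(iteratedDeriv 3 v t - lam * deriv v t))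
      (fun t => -(iteratedDeriv 4 v t - lam * iteratedDeriv 2 v t))
      _ q 0 (-M) lam (Real.sqrt mu) hlam0 (Real.sqrt_nonneg _) (fun t => (hv0 t).neg)
      (fun t => (hv1 t).neg) (fun t => (hv2 t).neg) (fun t => by ring)
      (fun t => ((hv3 t).sub ((hv1 t).const_mul lam)).neg)
      (fun t => ((hv4 t).sub ((hv2 t).const_mul lam)).neg) hq0
      (fun t => by linarith [heq t]) (fun t => by linarith [hpos t])
      (fun t => neg_le_neg (hM t)) (fun t ht => by rw [hzero t (neg_eq_zero.1 ht)]; simp) t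
      (by linarith)
    have h2 := mul_le_mul_of_nonpos_right hγ.1 h.le
    linarith
  · rw [hzero t h, h]; simp
end

section
/- Let n ≥ 5 be an integer and let v : ℝ → ℝ be a four times continuously differentiable positive solution of the Delaunay ODE on ℝ with v'(0) = 0 and v'''(0) = 0. Set ε := v(0), α := (1/(2(n−2)))·((n²/4)·ε − v''(0)) and β := (1/(2(n−2)))·(v''(0) − ((n−4)²/4)·ε). Then for every t ∈ ℝ, v(t) = α·cosh(((n−4)/2)·t) + β·cosh((n/2)·t) + (n(n−4)(n²−4)/16)·e^(((n−4)/2)t) · ∫₀ᵗ e^((4−n)s) ∫₀ˢ e^(−2x) ∫₀ˣ e^(ny) ∫₀ʸ e^(−(n/2)z) · v(z)^((n+4)/(n−4)) dz dy dx ds. -/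
theorem ftc_aux {F G : ℝ → ℝ} (hG : Continuous G) (h : ∀ t, HasDerivAt F (G t) t)
    (h0 : F 0 = 0) (t : ℝ) : F t = ∫ s in (0:ℝ)..t, G s := by
  rw [intervalIntegral.integral_eq_sub_of_hasDerivAt (fun x _ => h x)
    (hG.intervalIntegrable _ _), h0, sub_zero]

theorem hexp_aux (c t : ℝ) :
    HasDerivAt (fun t : ℝ => Real.exp (c * t)) (c * Real.exp (c * t)) t := by
  have := ((hasDerivAt_id t).const_mul c).exp
  simpa [mul_comm] using this

theorem rep_aux (n : ℝ) (u0 u1 u2 u3 u4 f : ℝ → ℝ) (hf : Continuous f)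
    (h0 : ∀ t, HasDerivAt u0 (u1 t) t) (h1 : ∀ t, HasDerivAt u1 (u2 t) t)
    (h2 : ∀ t, HasDerivAt u2 (u3 t) t) (h3 : ∀ t, HasDerivAt u3 (u4 t) t)
    (z0 : u0 0 = 0) (z1 : u1 0 = 0) (z2 : u2 0 = 0) (z3 : u3 0 = 0)
    (hode : ∀ t, u4 t - ((n^2 - 4*n + 8)/2) * u2 t + (n^2 * (n-4)^2 / 16) * u0 t = f t) (t : ℝ) :
    u0 t = Real.exp ((n - 4)/2 * t) *
          ∫ s in (0:ℝ)..t, Real.exp ((4 - n) * s) *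
            ∫ x in (0:ℝ)..s, Real.exp (-2 * x) *
              ∫ y in (0:ℝ)..x, Real.exp (n * y) *
                ∫ z in (0:ℝ)..y, Real.exp (-n/2 * z) * f z := by
  have c0 : Continuous u0 := continuous_iff_continuousAt.2 fun t => (h0 t).continuousAt
  have c1 : Continuous u1 := continuous_iff_continuousAt.2 fun t => (h1 t).continuousAt
  have c2 : Continuous u2 := continuous_iff_continuousAt.2 fun t => (h2 t).continuousAt
  have c3 : Continuous u3 := continuous_iff_continuousAt.2 fun t => (h3 t).continuousAt
  have e4 : ∀ y, Real.exp (-n/2 * y) *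
      (u3 y - ((n-4)/2)^2 * u1 y + n/2 * (u2 y - ((n-4)/2)^2 * u0 y)) =
      ∫ z in (0:ℝ)..y, Real.exp (-n/2 * z) * f z := by
    apply ftc_aux (F := fun y => Real.exp (-n/2 * y) *
      (u3 y - ((n-4)/2)^2 * u1 y + n/2 * (u2 y - ((n-4)/2)^2 * u0 y)))
    · fun_prop
    · intro t
      have := (hexp_aux (-n/2) t).mul (((h3 t).sub ((h1 t).const_mul (((n-4)/2)^2))).add
        (((h2 t).sub ((h0 t).const_mul (((n-4)/2)^2))).const_mul (n/2)))
      refine this.congr_deriv (Eq.symm ?_)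
      rw [← hode]
      simp only [Pi.add_apply, Pi.sub_apply]
      ring
    · simp [z0, z1, z2, z3]
  have e3 : ∀ y, Real.exp (n/2 * y) * (u2 y - ((n-4)/2)^2 * u0 y) =
      ∫ y in (0:ℝ)..y, Real.exp (n * y) * ∫ z in (0:ℝ)..y, Real.exp (-n/2 * z) * f z := by
    simp_rw [← e4]
    apply ftc_aux (F := fun y => Real.exp (n/2 * y) * (u2 y - ((n-4)/2)^2 * u0 y))
    · fun_prop
    · intro t
      have := (hexp_aux (n/2) t).mul ((h2 t).sub ((h0 t).const_mul (((n-4)/2)^2)))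
      refine this.congr_deriv (Eq.symm ?_)
      rw [← mul_assoc, ← Real.exp_add, show n * t + -n/2 * t = n/2 * t by ring]
      simp only [Pi.sub_apply]
      ring
    · simp [z0, z2]
  have e2 : ∀ y, Real.exp ((n-4)/2 * y) * (u1 y - ((n-4)/2) * u0 y) =
      ∫ x in (0:ℝ)..y, Real.exp (-2 * x) * ∫ y in (0:ℝ)..x, Real.exp (n * y) *
        ∫ z in (0:ℝ)..y, Real.exp (-n/2 * z) * f z := by
    simp_rw [← e3]
    apply ftc_aux (F := fun y => Real.exp ((n-4)/2 * y) * (u1 y - ((n-4)/2) * u0 y))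
    · fun_prop
    · intro t
      have := (hexp_aux ((n-4)/2) t).mul ((h1 t).sub ((h0 t).const_mul ((n-4)/2)))
      refine this.congr_deriv (Eq.symm ?_)
      rw [← mul_assoc, ← Real.exp_add, show -2 * t + n/2 * t = (n-4)/2 * t by ring]
      simp only [Pi.sub_apply]
      ring
    · simp [z0, z1]
  have e1 : ∀ y, Real.exp (-((n-4)/2) * y) * u0 y =
      ∫ s in (0:ℝ)..y, Real.exp ((4 - n) * s) *
       ∫ x in (0:ℝ)..s, Real.exp (-2 * x) * ∫ y in (0:ℝ)..x, Real.exp (n * y) *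
        ∫ z in (0:ℝ)..y, Real.exp (-n/2 * z) * f z := by
    simp_rw [← e2]
    apply ftc_aux (F := fun y => Real.exp (-((n-4)/2) * y) * u0 y)
    · fun_prop
    · intro t
      have := (hexp_aux (-((n-4)/2)) t).mul (h0 t)
      refine this.congr_deriv (Eq.symm ?_)
      rw [← mul_assoc, ← Real.exp_add, show (4-n) * t + (n-4)/2 * t = -((n-4)/2) * t by ring]
      ring
    · simp [z0]
  rw [← e1, ← mul_assoc, ← Real.exp_add]
  simp

theorem hcosh_aux (c t : ℝ) :
    HasDerivAt (fun t : ℝ => Real.cosh (c * t)) (c * Real.sinh (c * t)) t := by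
  have := ((hasDerivAt_id t).const_mul c).cosh
  simpa [mul_comm] using this

theorem hsinh_aux (c t : ℝ) :
    HasDerivAt (fun t : ℝ => Real.sinh (c * t)) (c * Real.cosh (c * t)) t := by
  have := ((hasDerivAt_id t).const_mul c).sinh
  simpa [mul_comm] using this


/-- Integral representation formula for a positive `C⁴` Delaunay solution
with `v'(0) = v'''(0) = 0`, in terms of `α·cosh(((n-4)/2)t) + β·cosh((n/2)t)` plus a
fourfold iterated integral of `v^((n+4)/(n-4))`. -/
theorem stmt_8 (n : ℕ) (hn : 5 ≤ n) (v : ℝ → ℝ) (hv : ContDiff ℝ 4 v)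
    (hpos : ∀ t, 0 < v t)
    (hode : ∀ t : ℝ,
      iteratedDeriv 4 v t - (((n : ℝ)^2 - 4*(n : ℝ) + 8)/2) * iteratedDeriv 2 v t
        + ((n : ℝ)^2 * ((n : ℝ) - 4)^2 / 16) * v t
        - ((n : ℝ) * ((n : ℝ) - 4) * ((n : ℝ)^2 - 4) / 16)
            * (v t) ^ (((n : ℝ) + 4)/((n : ℝ) - 4)) = 0)
    (hd1 : deriv v 0 = 0) (hd3 : iteratedDeriv 3 v 0 = 0)
    (ε α β : ℝ) (hε : ε = v 0)
    (hα : α = (1/(2*((n : ℝ) - 2))) * ((n : ℝ)^2/4 * ε - iteratedDeriv 2 v 0))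
    (hβ : β = (1/(2*((n : ℝ) - 2))) * (iteratedDeriv 2 v 0 - ((n : ℝ) - 4)^2/4 * ε)) :
    ∀ t : ℝ,
      v t = α * Real.cosh (((n : ℝ) - 4)/2 * t) + β * Real.cosh ((n : ℝ)/2 * t)
        + ((n : ℝ) * ((n : ℝ) - 4) * ((n : ℝ)^2 - 4) / 16) * Real.exp (((n : ℝ) - 4)/2 * t) *
          ∫ s in (0:ℝ)..t, Real.exp (((4 : ℝ) - (n : ℝ)) * s) *
            ∫ x in (0:ℝ)..s, Real.exp (-2 * x) *
              ∫ y in (0:ℝ)..x, Real.exp ((n : ℝ) * y) *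
                ∫ z in (0:ℝ)..y, Real.exp (-(n : ℝ)/2 * z)
                  * (v z) ^ (((n : ℝ) + 4)/((n : ℝ) - 4)) := by
  intro t
  have hN : (5:ℝ) ≤ n := by exact_mod_cast hn
  generalize (n : ℝ) = N at *
  have hC : N * (N - 4) * (N^2 - 4) / 16 ≠ 0 := by
    have : 0 < N * (N - 4) * (N^2 - 4) / 16 := by
      have : 0 < N - 4 := by linarith
      have : 0 < N^2 - 4 := by nlinarith
      positivity
    exact this.ne'
  have hN2 : N - 2 ≠ 0 := by intro h; linarith
  have hd : ∀ k : ℕ, k < 4 → ∀ t, HasDerivAt (iteratedDeriv k v) (iteratedDeriv (k+1) v t) t := by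
    intro k hk t
    rw [iteratedDeriv_succ]
    exact ((hv.differentiable_iteratedDeriv k (by exact_mod_cast hk)) t).hasDerivAt
  have g0 := hd 0 (by norm_num)
  have g1 := hd 1 (by norm_num)
  have g2 := hd 2 (by norm_num)
  have g3 := hd 3 (by norm_num)
  simp only [iteratedDeriv_zero, zero_add, Nat.reduceAdd] at g0 g1 g2 g3
  generalize hCd : N * (N - 4) * (N^2 - 4) / 16 = C at *
  have ka := fun t => (hcosh_aux ((N-4)/2) t)
  have kb := fun t => (hcosh_aux (N/2) t)
  have la := fun t => (hsinh_aux ((N-4)/2) t)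
  have lb := fun t => (hsinh_aux (N/2) t)
  have hab : α + β = ε := by rw [hα, hβ]; field_simp; ring
  have hab2 : α * ((N-4)/2)^2 + β * (N/2)^2 = iteratedDeriv 2 v 0 := by
    rw [hα, hβ]; field_simp; ring
  have hd1' : iteratedDeriv 1 v 0 = 0 := by rw [iteratedDeriv_one]; exact hd1
  have key := rep_aux N
    (fun t => C⁻¹ * (v t - (α * Real.cosh ((N-4)/2 * t) + β * Real.cosh (N/2*t))))
    (fun t => C⁻¹ * (iteratedDeriv 1 v t - (α * ((N-4)/2 * Real.sinh ((N-4)/2 * t))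
      + β * (N/2 * Real.sinh (N/2*t)))))
    (fun t => C⁻¹ * (iteratedDeriv 2 v t - (α * ((N-4)/2 * ((N-4)/2 * Real.cosh ((N-4)/2 * t)))
      + β * (N/2 * (N/2 * Real.cosh (N/2*t))))))
    (fun t => C⁻¹ * (iteratedDeriv 3 v t -
      (α * ((N-4)/2 * ((N-4)/2 * ((N-4)/2 * Real.sinh ((N-4)/2 * t))))
      + β * (N/2 * (N/2 * (N/2 * Real.sinh (N/2*t)))))))
    (fun t => C⁻¹ * (iteratedDeriv 4 v t -
      (α * ((N-4)/2 * ((N-4)/2 * ((N-4)/2 * ((N-4)/2 * Real.cosh ((N-4)/2 * t)))))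
      + β * (N/2 * (N/2 * (N/2 * (N/2 * Real.cosh (N/2*t))))))))
    (fun t => v t ^ ((N+4)/(N-4)))
    (hv.continuous.rpow_const fun x => Or.inl (hpos x).ne')
    (fun t => ((g0 t).sub (((ka t).const_mul α).add ((kb t).const_mul β))).const_mul _)
    (fun t => ((g1 t).sub ((((la t).const_mul _).const_mul α).add
      (((lb t).const_mul _).const_mul β))).const_mul _)
    (fun t => ((g2 t).sub (((((ka t).const_mul _).const_mul _).const_mul α).add
      ((((kb t).const_mul _).const_mul _).const_mul β))).const_mul _)
    (fun t => ((g3 t).sub ((((((la t).const_mul _).const_mul _).const_mul _).const_mul α).add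
      (((((lb t).const_mul _).const_mul _).const_mul _).const_mul β))).const_mul _)
    (by simp [← hε, ← hab])
    (by simp [hd1'])
    (by simp only [← hab2, mul_zero, Real.cosh_zero]; ring)
    (by simp [hd3])
    (by
      intro t
      have h : v t ^ ((N+4)/(N-4)) = C⁻¹ * (C * v t ^ ((N+4)/(N-4))) := by
        field_simp
      have h2 := hode t
      rw [h, show C * v t ^ ((N+4)/(N-4)) = iteratedDeriv 4 v t
        - ((N^2 - 4*N + 8)/2) * iteratedDeriv 2 v t + (N^2 * (N - 4)^2 / 16) * v t by linarith]
      ring)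
    t
  rw [mul_assoc, ← key]
  field_simp
  ring
end

section
/- Let n ≥ 5 be an integer. There exists a constant c > 0, depending only on n, with the following property: for every ε ∈ (0,1) and every four times continuously differentiable positive solution v : ℝ → ℝ of the Delaunay ODE with v(0) = ε, v'(0) = 0, v'''(0) = 0, and 0 < v(t) ≤ ε·e^(((n−4)/2)·|t|) for all t ∈ ℝ, one has, for all t ≥ 0, |v(t) − α·cosh(((n−4)/2)·t) − β·cosh((n/2)·t)| ≤ c·ε^((n+4)/(n−4))·e^(((n+4)/2)·t), where α := (1/(2(n−2)))·((n²/4)·ε − v''(0)) and β := (1/(2(n−2)))·(v''(0) − ((n−4)²/4)·ε). -/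
theorem aux_one (u u' : ℝ → ℝ) (l m C : ℝ) (hlm : l < m) (hC : 0 ≤ C)
    (hu : ∀ t, HasDerivAt u (u' t) t) (h0 : u 0 ≤ 0)
    (hb : ∀ t, 0 ≤ t → u' t - l * u t ≤ C * Real.exp (m * t)) :
    ∀ t, 0 ≤ t → u t ≤ C / (m - l) * Real.exp (m * t) := by
  have hml : 0 < m - l := sub_pos.2 hlm
  set F : ℝ → ℝ := fun t => Real.exp (-l * t) * (u t - C / (m - l) * Real.exp (m * t)) with hF
  have hd : ∀ t, HasDerivAt F
      (Real.exp (-l * t) * (u' t - l * u t - C * Real.exp (m * t))) t := by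
    intro t
    have e1 : HasDerivAt (fun t : ℝ => Real.exp (-l * t)) (Real.exp (-l * t) * (-l * 1)) t :=
      ((hasDerivAt_id t).const_mul (-l)).exp
    have e2 : HasDerivAt (fun t : ℝ => Real.exp (m * t)) (Real.exp (m * t) * (m * 1)) t :=
      ((hasDerivAt_id t).const_mul m).exp
    have e3 := e1.mul ((hu t).sub (e2.const_mul (C / (m - l))))
    refine e3.congr_deriv ?_
    simp only [Pi.sub_apply]
    field_simp
    ring
  have hanti : AntitoneOn F (Set.Ici 0) := by
    apply antitoneOn_of_deriv_nonpos (convex_Ici 0)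
    · exact fun t _ => (hd t).continuousAt.continuousWithinAt
    · exact fun t _ => (hd t).differentiableAt.differentiableWithinAt
    · intro t ht
      rw [interior_Ici] at ht
      rw [(hd t).deriv]
      have := hb t (le_of_lt ht)
      exact mul_nonpos_of_nonneg_of_nonpos (Real.exp_pos _).le (by linarith)
  intro t ht
  have h1 := hanti (Set.mem_Ici.2 le_rfl) (Set.mem_Ici.2 ht) ht
  have h2 : F 0 ≤ 0 := by
    have : 0 ≤ C / (m - l) := by positivity
    simp [hF]
    linarith
  have h3 : F t ≤ 0 := h1.trans h2
  have h4 := Real.exp_pos (-l * t)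
  simp only [hF] at h3
  by_contra hcon
  push Not at hcon
  have := mul_pos h4 (sub_pos.2 hcon)
  linarith

theorem aux_abs (u u' : ℝ → ℝ) (l m C : ℝ) (hlm : l < m) (hC : 0 ≤ C)
    (hu : ∀ t, HasDerivAt u (u' t) t) (h0 : u 0 = 0)
    (hb : ∀ t, 0 ≤ t → |u' t - l * u t| ≤ C * Real.exp (m * t)) :
    ∀ t, 0 ≤ t → |u t| ≤ C / (m - l) * Real.exp (m * t) := by
  intro t ht
  rw [abs_le']
  refine ⟨aux_one u u' l m C hlm hC hu h0.le (fun s hs => (abs_le'.1 (hb s hs)).1) t ht, ?_⟩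
  refine aux_one (fun s => -u s) (fun s => -u' s) l m C hlm hC (fun s => (hu s).neg) (by simp [h0])
    (fun s hs => ?_) t ht
  have := (abs_le'.1 (hb s hs)).2
  linarith

theorem aux_four (w w1 w2 w3 w4 : ℝ → ℝ) (a b m C : ℝ) (ha : 0 < a) (hb : 0 < b)
    (ham : a < m) (hbm : b < m) (hC : 0 ≤ C)
    (h0 : ∀ t, HasDerivAt w (w1 t) t) (h1 : ∀ t, HasDerivAt w1 (w2 t) t)
    (h2 : ∀ t, HasDerivAt w2 (w3 t) t) (h3 : ∀ t, HasDerivAt w3 (w4 t) t)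
    (z0 : w 0 = 0) (z1 : w1 0 = 0) (z2 : w2 0 = 0) (z3 : w3 0 = 0)
    (hg : ∀ t, 0 ≤ t → |w4 t - (a^2 + b^2) * w2 t + a^2 * b^2 * w t| ≤ C * Real.exp (m * t)) :
    ∀ t, 0 ≤ t → |w t| ≤ C / (m - a) / (m - -a) / (m - b) / (m - -b) * Real.exp (m * t) := by
  have p1 : 0 < m - a := by linarith
  have p2 : 0 < m - -a := by linarith
  have p3 : 0 < m - b := by linarith
  have s3 := aux_abs (fun t => w3 t + a * w2 t - b^2 * w1 t - a * b^2 * w t)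
    (fun t => w4 t + a * w3 t - b^2 * w2 t - a * b^2 * w1 t) a m C ham hC
    (fun t => ((((h3 t).add ((h2 t).const_mul a)).sub ((h1 t).const_mul (b^2))).sub
      ((h0 t).const_mul (a * b^2)))) (by simp [z0, z1, z2, z3])
    (fun t ht => by
      convert hg t ht using 2
      ring)
  have s2 := aux_abs (fun t => w2 t - b^2 * w t) (fun t => w3 t - b^2 * w1 t) (-a) m (C / (m - a))
    (by linarith) (by positivity) (fun t => (h2 t).sub ((h0 t).const_mul (b^2)))
    (by simp [z0, z2]) (fun t ht => by
      convert s3 t ht using 2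
      ring)
  have s1 := aux_abs (fun t => w1 t + b * w t) (fun t => w2 t + b * w1 t) b m (C / (m - a) / (m - -a))
    hbm (by positivity) (fun t => (h1 t).add ((h0 t).const_mul b))
    (by simp [z0, z1]) (fun t ht => by
      convert s2 t ht using 2
      ring)
  exact aux_abs w w1 (-b) m _
    (by linarith) (by positivity) h0 z0 (fun t ht => by
      convert s1 t ht using 2
      ring)

theorem aux_cosh (k t : ℝ) :
    HasDerivAt (fun t => Real.cosh (k * t)) (k * Real.sinh (k * t)) t := by
  have := ((hasDerivAt_id t).const_mul k).cosh
  refine this.congr_deriv ?_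
  simp
  ring

theorem aux_sinh (k t : ℝ) :
    HasDerivAt (fun t => Real.sinh (k * t)) (k * Real.cosh (k * t)) t := by
  have := ((hasDerivAt_id t).const_mul k).sinh
  refine this.congr_deriv ?_
  simp
  ring

theorem aux_iter (v : ℝ → ℝ) (hv : ContDiff ℝ 4 v) (k : ℕ) (hk : k < 4) (t : ℝ) :
    HasDerivAt (iteratedDeriv k v) (iteratedDeriv (k+1) v t) t := by
  rw [iteratedDeriv_succ]
  exact ((hv.differentiable_iteratedDeriv k (by exact_mod_cast hk)) t).hasDerivAt


/-- Uniform estimate `|v(t) - α·cosh(((n-4)/2)t) - β·cosh((n/2)t)| ≤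
c·ε^((n+4)/(n-4))·e^(((n+4)/2)t)` for `t ≥ 0`, for positive `C⁴` Delaunay solutions with
`v(0) = ε ∈ (0,1)`, `v'(0) = v'''(0) = 0` and `v(t) ≤ ε·e^(((n-4)/2)|t|)`. -/
theorem stmt_9 (n : ℕ) (hn : 5 ≤ n) :
    ∃ c : ℝ, 0 < c ∧
      ∀ ε : ℝ, ε ∈ Set.Ioo (0:ℝ) 1 →
        ∀ v : ℝ → ℝ, ContDiff ℝ 4 v → (∀ t, 0 < v t) →
          (∀ t : ℝ,
            iteratedDeriv 4 v t - (((n : ℝ)^2 - 4*(n : ℝ) + 8)/2) * iteratedDeriv 2 v t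
              + ((n : ℝ)^2 * ((n : ℝ) - 4)^2 / 16) * v t
              - ((n : ℝ) * ((n : ℝ) - 4) * ((n : ℝ)^2 - 4) / 16)
                  * (v t) ^ (((n : ℝ) + 4)/((n : ℝ) - 4)) = 0) →
          v 0 = ε → deriv v 0 = 0 → iteratedDeriv 3 v 0 = 0 →
          (∀ t : ℝ, v t ≤ ε * Real.exp (((n : ℝ) - 4)/2 * |t|)) →
          ∀ t : ℝ, 0 ≤ t →
            |v t
              - ((1/(2*((n : ℝ) - 2))) * ((n : ℝ)^2/4 * ε - iteratedDeriv 2 v 0))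
                  * Real.cosh (((n : ℝ) - 4)/2 * t)
              - ((1/(2*((n : ℝ) - 2))) * (iteratedDeriv 2 v 0 - ((n : ℝ) - 4)^2/4 * ε))
                  * Real.cosh ((n : ℝ)/2 * t)|
            ≤ c * ε ^ (((n : ℝ) + 4)/((n : ℝ) - 4)) * Real.exp (((n : ℝ) + 4)/2 * t) := by
  have hn' : (5:ℝ) ≤ n := by exact_mod_cast hn
  set x : ℝ := (n:ℝ) with hx
  clear_value x
  have q1 : 0 < x - 4 := by linarith
  have q2 : 0 < x^2 - 4 := by nlinarith
  have q3 : 0 < x - 2 := by linarith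
  have q0 : 0 < x := by linarith
  set K : ℝ := x * (x - 4) * (x^2 - 4) / 16 with hK
  have hKp : 0 < K := by positivity
  set p : ℝ := (x + 4) / (x - 4) with hp
  have hpp : 0 < p := by positivity
  set a : ℝ := (x - 4) / 2 with ha
  set b : ℝ := x / 2 with hb
  set m : ℝ := (x + 4) / 2 with hm
  have ha0 : 0 < a := by positivity
  have hb0 : 0 < b := by positivity
  have ham : a < m := by rw [ha, hm]; linarith
  have hbm : b < m := by rw [hb, hm]; linarith
  have r1 : 0 < m - a := by linarith
  have r2 : 0 < m - -a := by linarith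
  have r3 : 0 < m - b := by linarith
  have r4 : 0 < m - -b := by linarith
  have hpa : a * p = m := by rw [ha, hp, hm]; field_simp
  refine ⟨K / (m - a) / (m - -a) / (m - b) / (m - -b), by positivity, ?_⟩
  intro ε hε v hv hpos hode hv0 hv1 hv3 hle t ht
  have hε0 : 0 < ε := hε.1
  set A : ℝ := (1/(2*(x - 2))) * (x^2/4 * ε - iteratedDeriv 2 v 0) with hA
  set B : ℝ := (1/(2*(x - 2))) * (iteratedDeriv 2 v 0 - (x - 4)^2/4 * ε) with hB
  have hAB : A + B = ε := by rw [hA, hB]; field_simp; ring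
  have hAB2 : A * a^2 + B * b^2 = iteratedDeriv 2 v 0 := by
    rw [hA, hB, ha, hb]; field_simp; ring
  have main := aux_four
    (fun t => v t - A * Real.cosh (a * t) - B * Real.cosh (b * t))
    (fun t => iteratedDeriv 1 v t - A * (a * Real.sinh (a * t)) - B * (b * Real.sinh (b * t)))
    (fun t => iteratedDeriv 2 v t - A * (a * (a * Real.cosh (a * t)))
      - B * (b * (b * Real.cosh (b * t))))
    (fun t => iteratedDeriv 3 v t - A * (a * (a * (a * Real.sinh (a * t))))
      - B * (b * (b * (b * Real.sinh (b * t)))))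
    (fun t => iteratedDeriv 4 v t - A * (a * (a * (a * (a * Real.cosh (a * t)))))
      - B * (b * (b * (b * (b * Real.cosh (b * t))))))
    a b m (K * ε ^ p) ha0 hb0 ham hbm (by positivity)
    (fun t => by
      have := aux_iter v hv 0 (by norm_num) t
      rw [iteratedDeriv_zero] at this
      exact (this.sub ((aux_cosh a t).const_mul A)).sub ((aux_cosh b t).const_mul B))
    (fun t => ((aux_iter v hv 1 (by norm_num) t).sub
      (((aux_sinh a t).const_mul a).const_mul A)).sub (((aux_sinh b t).const_mul b).const_mul B))
    (fun t => ((aux_iter v hv 2 (by norm_num) t).sub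
      ((((aux_cosh a t).const_mul a).const_mul a).const_mul A)).sub
      ((((aux_cosh b t).const_mul b).const_mul b).const_mul B))
    (fun t => ((aux_iter v hv 3 (by norm_num) t).sub
      (((((aux_sinh a t).const_mul a).const_mul a).const_mul a).const_mul A)).sub
      (((((aux_sinh b t).const_mul b).const_mul b).const_mul b).const_mul B))
    (by simp [hv0]; linarith)
    (by simp [iteratedDeriv_one, hv1])
    (by simp; linarith)
    (by simp [hv3])
    (fun t ht => by
      have e : iteratedDeriv 4 v t - A * (a * (a * (a * (a * Real.cosh (a * t)))))
          - B * (b * (b * (b * (b * Real.cosh (b * t)))))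
          - (a^2 + b^2) * (iteratedDeriv 2 v t - A * (a * (a * Real.cosh (a * t)))
          - B * (b * (b * Real.cosh (b * t))))
          + a^2 * b^2 * (v t - A * Real.cosh (a * t) - B * Real.cosh (b * t))
          = K * v t ^ p := by
        have h := hode t
        have c1 : (x^2 - 4*x + 8)/2 = a^2 + b^2 := by rw [ha, hb]; ring
        have c2 : x^2 * (x - 4)^2/16 = a^2 * b^2 := by rw [ha, hb]; ring
        rw [c1, c2] at h
        linear_combination h
      simp only [e]
      have hvp : 0 < v t ^ p := Real.rpow_pos_of_pos (hpos t) p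
      rw [abs_of_pos (by positivity), mul_assoc]
      refine mul_le_mul_of_nonneg_left ?_ hKp.le
      have h1 := hle t
      rw [abs_of_nonneg ht] at h1
      have h2 := Real.rpow_le_rpow (hpos t).le h1 hpp.le
      rw [Real.mul_rpow hε0.le (Real.exp_pos _).le, ← Real.exp_mul] at h2
      have e2 : a * t * p = m * t := by rw [← hpa]; ring
      rwa [e2] at h2)
  have := main t ht
  refine this.trans (le_of_eq ?_)
  ring
end

section
/- Let n ≥ 5 be an integer. There exists a constant c > 0, depending only on n, with the following property: for every ε ∈ (0,1) and every four times continuously differentiable positive solution v : ℝ → ℝ of the Delaunay ODE with v(0) = ε, v'(0) = 0, v'''(0) = 0, and 0 < v(t) ≤ ε·e^(((n−4)/2)·|t|) for all t ∈ ℝ, the function u on ℝⁿ∖{0} defined by u(x) = ‖x‖^((4−n)/2)·v(−log‖x‖) satisfies, for all x with 0 < ‖x‖ ≤ 1, |u(x) − (α/2)·(1 + ‖x‖^(4−n)) − (β/2)·(‖x‖² + ‖x‖^(2−n))| ≤ c·ε^((n+4)/(n−4))·‖x‖^(−n), where α := (1/(2(n−2)))·((n²/4)·ε − v''(0)) and β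 := (1/(2(n−2)))·(v''(0) − ((n−4)²/4)·ε). -/
theorem comp_up (l g M : ℝ) (y f : ℝ → ℝ) (hM : 0 ≤ M) (hg : 1 ≤ g - l)
    (hy : ∀ t, HasDerivAt y (l * y t + f t) t) (h0 : y 0 = 0)
    (hf : ∀ t, 0 ≤ t → f t ≤ M * Real.exp (g * t)) :
    ∀ t, 0 ≤ t → y t ≤ M * Real.exp (g * t) := by
  have hd : ∀ t, HasDerivAt (fun t => Real.exp (-l * t) * y t - M * Real.exp ((g - l) * t))
      (Real.exp (-l * t) * f t - M * (g - l) * Real.exp ((g - l) * t)) t := by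
    intro t
    have e1 : HasDerivAt (fun t : ℝ => Real.exp (-l * t)) (Real.exp (-l * t) * (-l * 1)) t :=
      ((hasDerivAt_id' t).const_mul (-l)).exp
    have e2 : HasDerivAt (fun t : ℝ => Real.exp ((g - l) * t))
        (Real.exp ((g - l) * t) * ((g - l) * 1)) t :=
      ((hasDerivAt_id' t).const_mul (g - l)).exp
    refine ((e1.mul (hy t)).sub (e2.const_mul M)).congr_deriv ?_
    ring
  have hanti : AntitoneOn (fun t => Real.exp (-l * t) * y t - M * Real.exp ((g - l) * t))
      (Set.Ici 0) := by
    apply antitoneOn_of_deriv_nonpos (convex_Ici 0)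
    · exact fun t _ => (hd t).continuousAt.continuousWithinAt
    · exact fun t _ => (hd t).differentiableAt.differentiableWithinAt
    · intro t ht
      rw [interior_Ici] at ht
      rw [(hd t).deriv]
      have h1 := mul_le_mul_of_nonneg_left (hf t (le_of_lt ht)) (Real.exp_pos (-l * t)).le
      have h2 : Real.exp (-l * t) * (M * Real.exp (g * t)) = M * Real.exp ((g - l) * t) := by
        rw [mul_left_comm, ← Real.exp_add]; ring_nf
      have h3 : 0 ≤ M * Real.exp ((g - l) * t) := by positivity
      nlinarith
  intro t ht
  have h := hanti (Set.mem_Ici.2 le_rfl) (Set.mem_Ici.2 ht) ht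
  simp only [h0, mul_zero, Real.exp_zero] at h
  have h4 : Real.exp (-l * t) * y t ≤ M * Real.exp ((g - l) * t) := by linarith
  have h5 := mul_le_mul_of_nonneg_left h4 (Real.exp_pos (l * t)).le
  have e1 : Real.exp (l * t) * (Real.exp (-l * t) * y t) = y t := by
    rw [← mul_assoc, ← Real.exp_add]; simp
  have e2 : Real.exp (l * t) * (M * Real.exp ((g - l) * t)) = M * Real.exp (g * t) := by
    rw [mul_left_comm, ← Real.exp_add]; ring_nf
  rwa [e1, e2] at h5

theorem comp_abs (l g M : ℝ) (y f : ℝ → ℝ) (hM : 0 ≤ M) (hg : 1 ≤ g - l)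
    (hy : ∀ t, HasDerivAt y (l * y t + f t) t) (h0 : y 0 = 0)
    (hf : ∀ t, 0 ≤ t → |f t| ≤ M * Real.exp (g * t)) :
    ∀ t, 0 ≤ t → |y t| ≤ M * Real.exp (g * t) := by
  intro t ht
  refine abs_le'.2 ⟨comp_up l g M y f hM hg hy h0 (fun t ht => (abs_le'.1 (hf t ht)).1) t ht, ?_⟩
  refine comp_up l g M (fun t => - y t) (fun t => - f t) hM hg ?_ (by simp [h0])
    (fun t ht => (abs_le'.1 (hf t ht)).2) t ht
  intro t
  exact (hy t).neg.congr_deriv (by ring)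

theorem core_est (a b g M : ℝ) (w0 w1 w2 w3 w4 F : ℝ → ℝ) (hM : 0 ≤ M)
    (ha : 0 ≤ a) (hb : 0 ≤ b) (hga : 1 ≤ g - a) (hgb : 1 ≤ g - b)
    (d0 : ∀ t, HasDerivAt w0 (w1 t) t) (d1 : ∀ t, HasDerivAt w1 (w2 t) t)
    (d2 : ∀ t, HasDerivAt w2 (w3 t) t) (d3 : ∀ t, HasDerivAt w3 (w4 t) t)
    (z0 : w0 0 = 0) (z1 : w1 0 = 0) (z2 : w2 0 = 0) (z3 : w3 0 = 0)
    (ode : ∀ t, w4 t - (a ^ 2 + b ^ 2) * w2 t + a ^ 2 * b ^ 2 * w0 t = F t)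
    (hF : ∀ t, 0 ≤ t → |F t| ≤ M * Real.exp (g * t)) :
    ∀ t, 0 ≤ t → |w0 t| ≤ M * Real.exp (g * t) := by
  have s1 := comp_abs a g M (fun t => w3 t + a * w2 t - b ^ 2 * w1 t - a * b ^ 2 * w0 t) F hM hga
    (fun t => by
      refine ((((d3 t).add ((d2 t).const_mul a)).sub ((d1 t).const_mul (b ^ 2))).sub
        ((d0 t).const_mul (a * b ^ 2))).congr_deriv ?_
      rw [← ode t]; ring) (by simp [z0, z1, z2, z3]) hF
  have s2 := comp_abs (-a) g M (fun t => w2 t - b ^ 2 * w0 t) _ hM (by linarith)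
    (fun t => by
      refine ((d2 t).sub ((d0 t).const_mul (b ^ 2))).congr_deriv ?_
      ring) (by simp [z0, z2]) s1
  have s3 := comp_abs b g M (fun t => w1 t + b * w0 t) _ hM hgb
    (fun t => by
      refine ((d1 t).add ((d0 t).const_mul b)).congr_deriv ?_
      ring) (by simp [z0, z1]) s2
  exact comp_abs (-b) g M w0 _ hM (by linarith)
    (fun t => by
      refine (d0 t).congr_deriv ?_
      ring) z0 s3

theorem core_lin (a b g M A B : ℝ) (v0 v1 v2 v3 v4 F : ℝ → ℝ) (hM : 0 ≤ M)
    (ha : 0 ≤ a) (hb : 0 ≤ b) (hga : 1 ≤ g - a) (hgb : 1 ≤ g - b)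
    (d0 : ∀ t, HasDerivAt v0 (v1 t) t) (d1 : ∀ t, HasDerivAt v1 (v2 t) t)
    (d2 : ∀ t, HasDerivAt v2 (v3 t) t) (d3 : ∀ t, HasDerivAt v3 (v4 t) t)
    (z0 : v0 0 = A + B) (z1 : v1 0 = 0) (z2 : v2 0 = a ^ 2 * A + b ^ 2 * B) (z3 : v3 0 = 0)
    (ode : ∀ t, v4 t - (a ^ 2 + b ^ 2) * v2 t + a ^ 2 * b ^ 2 * v0 t = F t)
    (hF : ∀ t, 0 ≤ t → |F t| ≤ M * Real.exp (g * t)) :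
    ∀ t, 0 ≤ t → |v0 t - A * Real.cosh (a * t) - B * Real.cosh (b * t)|
      ≤ M * Real.exp (g * t) := by
  have hc : ∀ k C t : ℝ, HasDerivAt (fun t => C * Real.cosh (k * t)) (C * k * Real.sinh (k * t)) t := by
    intro k C t
    exact ((((hasDerivAt_id' t).const_mul k).cosh).const_mul C).congr_deriv (by ring)
  have hs : ∀ k C t : ℝ, HasDerivAt (fun t => C * Real.sinh (k * t)) (C * k * Real.cosh (k * t)) t := by
    intro k C t
    exact ((((hasDerivAt_id' t).const_mul k).sinh).const_mul C).congr_deriv (by ring)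
  exact core_est a b g M (fun t => v0 t - A * Real.cosh (a * t) - B * Real.cosh (b * t))
    (fun t => v1 t - A * a * Real.sinh (a * t) - B * b * Real.sinh (b * t))
    (fun t => v2 t - A * a * a * Real.cosh (a * t) - B * b * b * Real.cosh (b * t))
    (fun t => v3 t - A * a * a * a * Real.sinh (a * t) - B * b * b * b * Real.sinh (b * t))
    (fun t => v4 t - A * a * a * a * a * Real.cosh (a * t) - B * b * b * b * b * Real.cosh (b * t))
    F hM ha hb hga hgb
    (fun t => ((d0 t).sub (hc _ _ t)).sub (hc _ _ t))
    (fun t => ((d1 t).sub (hs _ _ t)).sub (hs _ _ t))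
    (fun t => ((d2 t).sub (hc _ _ t)).sub (hc _ _ t))
    (fun t => ((d3 t).sub (hs _ _ t)).sub (hs _ _ t))
    (by simp [z0]) (by simp [z1]) (by simp [z2]; ring) (by simp [z3])
    (fun t => by rw [← ode t]; ring) hF

/-- Uniform estimate for `u(x) = ‖x‖^((4-n)/2)·v(-log‖x‖)` on the punctured
unit ball: `|u(x) - (α/2)(1 + ‖x‖^(4-n)) - (β/2)(‖x‖² + ‖x‖^(2-n))| ≤
c·ε^((n+4)/(n-4))·‖x‖^(-n)`, for positive `C⁴` Delaunay solutions with `v(0) = ε ∈ (0,1)`,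
`v'(0) = v'''(0) = 0` and `v(t) ≤ ε·e^(((n-4)/2)|t|)`. -/
theorem stmt_11 (n : ℕ) (hn : 5 ≤ n) :
    ∃ c : ℝ, 0 < c ∧
      ∀ ε : ℝ, ε ∈ Set.Ioo (0:ℝ) 1 →
        ∀ v : ℝ → ℝ, ContDiff ℝ 4 v → (∀ t, 0 < v t) →
          (∀ t : ℝ,
            iteratedDeriv 4 v t - (((n : ℝ)^2 - 4*(n : ℝ) + 8)/2) * iteratedDeriv 2 v t
              + ((n : ℝ)^2 * ((n : ℝ) - 4)^2 / 16) * v t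
              - ((n : ℝ) * ((n : ℝ) - 4) * ((n : ℝ)^2 - 4) / 16)
                  * (v t) ^ (((n : ℝ) + 4)/((n : ℝ) - 4)) = 0) →
          v 0 = ε → deriv v 0 = 0 → iteratedDeriv 3 v 0 = 0 →
          (∀ t : ℝ, v t ≤ ε * Real.exp (((n : ℝ) - 4)/2 * |t|)) →
          ∀ x : EuclideanSpace ℝ (Fin n), x ≠ 0 → ‖x‖ ≤ 1 →
            |‖x‖ ^ (((4 : ℝ) - (n : ℝ))/2) * v (-Real.log ‖x‖)
              - ((1/(2*((n : ℝ) - 2))) * ((n : ℝ)^2/4 * ε - iteratedDeriv 2 v 0))/2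
                  * (1 + ‖x‖ ^ ((4 : ℝ) - (n : ℝ)))
              - ((1/(2*((n : ℝ) - 2))) * (iteratedDeriv 2 v 0 - ((n : ℝ) - 4)^2/4 * ε))/2
                  * (‖x‖^2 + ‖x‖ ^ ((2 : ℝ) - (n : ℝ)))|
            ≤ c * ε ^ (((n : ℝ) + 4)/((n : ℝ) - 4)) * ‖x‖ ^ (-(n : ℝ)) := by
  have hn5 : (5 : ℝ) ≤ n := by exact_mod_cast hn
  have hK : 0 < (n : ℝ) * ((n : ℝ) - 4) * ((n : ℝ)^2 - 4) / 16 := by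
    have h1 : 0 < (n : ℝ) - 4 := by linarith
    have h2 : 0 < (n : ℝ)^2 - 4 := by nlinarith
    positivity
  refine ⟨_, hK, ?_⟩
  intro ε hε v hv hpos hode hv0 hv1 hv3 hbd x hx hx1
  set K := (n : ℝ) * ((n : ℝ) - 4) * ((n : ℝ)^2 - 4) / 16 with hKdef
  have h4 : (n : ℝ) - 4 ≠ 0 := by intro h; linarith
  have h2 : (n : ℝ) - 2 ≠ 0 := by intro h; linarith
  have hD : ∀ k : ℕ, k < 4 → ∀ t, HasDerivAt (iteratedDeriv k v) (iteratedDeriv (k+1) v t) t := by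
    intro k hk t
    rw [iteratedDeriv_succ]
    exact ((hv.differentiable_iteratedDeriv k (by exact_mod_cast hk)) t).hasDerivAt
  have hε0 : 0 < ε := hε.1
  set p := ((n : ℝ) + 4)/((n : ℝ) - 4) with hp
  have hp0 : 0 ≤ p := div_nonneg (by linarith) (by linarith)
  set A := (1/(2*((n : ℝ) - 2))) * ((n : ℝ)^2/4 * ε - iteratedDeriv 2 v 0) with hA
  set B := (1/(2*((n : ℝ) - 2))) * (iteratedDeriv 2 v 0 - ((n : ℝ) - 4)^2/4 * ε) with hB
  have key := core_lin (((n : ℝ) - 4)/2) ((n : ℝ)/2) (((n : ℝ) + 4)/2) (K * ε ^ p) A B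
    (iteratedDeriv 0 v) (iteratedDeriv 1 v) (iteratedDeriv 2 v) (iteratedDeriv 3 v)
    (iteratedDeriv 4 v) (fun t => K * v t ^ p) (by positivity) (by linarith) (by linarith)
    (by linarith) (by linarith) (hD 0 (by norm_num)) (hD 1 (by norm_num)) (hD 2 (by norm_num))
    (hD 3 (by norm_num))
    (by rw [iteratedDeriv_zero, hv0, hA, hB]; field_simp; ring)
    (by rw [iteratedDeriv_one, hv1])
    (by rw [hA, hB]; field_simp; ring) hv3
    (fun t => by rw [iteratedDeriv_zero]; linear_combination hode t)
    (fun t ht => by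
      have h := hbd t
      rw [abs_of_nonneg ht] at h
      have hr := Real.rpow_le_rpow (hpos t).le h hp0
      rw [Real.mul_rpow hε0.le (Real.exp_pos _).le, ← Real.exp_mul] at hr
      have he : ((n : ℝ) - 4)/2 * t * p = ((n : ℝ) + 4)/2 * t := by
        rw [hp]; field_simp
      rw [he] at hr
      have := Real.rpow_nonneg (hpos t).le p
      rw [abs_of_nonneg (by positivity), mul_assoc]
      exact mul_le_mul_of_nonneg_left hr hK.le)
  have hr : 0 < ‖x‖ := norm_pos_iff.2 hx
  have ht : 0 ≤ -Real.log ‖x‖ := by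
    have := Real.log_nonpos hr.le hx1
    linarith
  have key2 := key _ ht
  rw [iteratedDeriv_zero] at key2
  have hpw : ∀ s : ℝ, ‖x‖ ^ s = Real.exp (Real.log ‖x‖ * s) := fun s => Real.rpow_def_of_pos hr s
  have hsq : ‖x‖ ^ 2 = Real.exp (Real.log ‖x‖ * 2) := by
    rw [← hpw]; norm_cast
  set L := Real.log ‖x‖ with hL
  rw [hpw, hpw, hpw, hpw, hsq]
  have hE := Real.exp_pos (L * (((4 : ℝ) - n)/2))
  have k3 := mul_le_mul_of_nonneg_left key2 hE.le
  rw [← abs_of_pos hE, ← abs_mul, abs_of_pos hE] at k3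
  have c1 : Real.exp (L * (((4 : ℝ) - n)/2)) * Real.cosh (((n : ℝ) - 4)/2 * -L)
      = (1 + Real.exp (L * (4 - n))) / 2 := by
    rw [Real.cosh_eq, mul_div_assoc', mul_add, ← Real.exp_add, ← Real.exp_add, add_comm,
      ← Real.exp_zero]
    ring_nf
  have c2 : Real.exp (L * (((4 : ℝ) - n)/2)) * Real.cosh ((n : ℝ)/2 * -L)
      = (Real.exp (L * 2) + Real.exp (L * (2 - n))) / 2 := by
    rw [Real.cosh_eq, mul_div_assoc', mul_add, ← Real.exp_add, ← Real.exp_add, add_comm]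
    ring_nf
  have c3 : Real.exp (L * (((4 : ℝ) - n)/2)) * (K * ε ^ p * Real.exp (((n : ℝ) + 4)/2 * -L))
      = K * ε ^ p * Real.exp (L * -n) := by
    rw [mul_left_comm, ← Real.exp_add]
    ring_nf
  rw [c3] at k3
  refine le_trans (le_of_eq ?_) k3
  congr 1
  linear_combination A * c1 + B * c2
end

section
/- Let n ≥ 5 be an integer and let u : ℝⁿ → ℝ be four times continuously differentiable on ℝⁿ∖{0}. Define the Kelvin transform K(u)(x) = ‖x‖^(4−n)·u(x/‖x‖²) for x ≠ 0. Then for every x ≠ 0, Δ(Δ(K(u)))(x) = ‖x‖^(−(n+4))·Δ(Δu)(x/‖x‖²). -/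
/-- The Euclidean Laplacian: sum of second partial derivatives in the standard
orthonormal coordinate directions of `EuclideanSpace ℝ (Fin n)`. -/
noncomputable def euclideanLaplacian {n : ℕ} (f : EuclideanSpace ℝ (Fin n) → ℝ)
    (x : EuclideanSpace ℝ (Fin n)) : ℝ :=
  ∑ i : Fin n,
    fderiv ℝ (fun y => fderiv ℝ f y (EuclideanSpace.single i 1)) x (EuclideanSpace.single i 1)

namespace Kelvin

variable {n : ℕ}

/-- Directional derivative. -/
noncomputable def pd (v : EuclideanSpace ℝ (Fin n)) (g : EuclideanSpace ℝ (Fin n) → ℝ) :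
    EuclideanSpace ℝ (Fin n) → ℝ := fun y => fderiv ℝ g y v

/-- Euler operator. -/
noncomputable def eu (g : EuclideanSpace ℝ (Fin n) → ℝ) :
    EuclideanSpace ℝ (Fin n) → ℝ := fun y => fderiv ℝ g y y

/-- Weighted inversion. -/
noncomputable def tr (a : ℝ) (g : EuclideanSpace ℝ (Fin n) → ℝ) :
    EuclideanSpace ℝ (Fin n) → ℝ := fun y => ‖y‖ ^ a * g ((‖y‖^2)⁻¹ • y)

theorem lap_eq (g : EuclideanSpace ℝ (Fin n) → ℝ) (x : EuclideanSpace ℝ (Fin n)) :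
    euclideanLaplacian g x =
      ∑ i : Fin n, pd (EuclideanSpace.single i 1) (pd (EuclideanSpace.single i 1) g) x := rfl

theorem nhds_U {x : EuclideanSpace ℝ (Fin n)} (hx : x ≠ 0) :
    ({(0 : EuclideanSpace ℝ (Fin n))}ᶜ : Set _) ∈ nhds x :=
  isOpen_compl_singleton.mem_nhds hx

theorem inv_ne {x : EuclideanSpace ℝ (Fin n)} (hx : x ≠ 0) : (‖x‖^2)⁻¹ • x ≠ 0 := by
  have : ‖x‖ ≠ 0 := norm_ne_zero_iff.2 hx
  exact smul_ne_zero (by positivity) hx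

theorem cd_fderiv {m : WithTop ℕ∞} {g : EuclideanSpace ℝ (Fin n) → ℝ}
    (hg : ContDiffOn ℝ (m+1) g {(0 : EuclideanSpace ℝ (Fin n))}ᶜ) :
    ContDiffOn ℝ m (fderiv ℝ g) {(0 : EuclideanSpace ℝ (Fin n))}ᶜ :=
  hg.fderiv_of_isOpen isOpen_compl_singleton le_rfl

theorem cd_pd {m : WithTop ℕ∞} {g : EuclideanSpace ℝ (Fin n) → ℝ}
    (v : EuclideanSpace ℝ (Fin n))
    (hg : ContDiffOn ℝ (m+1) g {(0 : EuclideanSpace ℝ (Fin n))}ᶜ) :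
    ContDiffOn ℝ m (pd v g) {(0 : EuclideanSpace ℝ (Fin n))}ᶜ :=
  (cd_fderiv hg).clm_apply contDiffOn_const

theorem cd_eu {m : WithTop ℕ∞} {g : EuclideanSpace ℝ (Fin n) → ℝ}
    (hg : ContDiffOn ℝ (m+1) g {(0 : EuclideanSpace ℝ (Fin n))}ᶜ) :
    ContDiffOn ℝ m (eu g) {(0 : EuclideanSpace ℝ (Fin n))}ᶜ :=
  (cd_fderiv hg).clm_apply contDiffOn_id

theorem cd_lap {m : WithTop ℕ∞} {g : EuclideanSpace ℝ (Fin n) → ℝ}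
    (hg : ContDiffOn ℝ (m+1+1) g {(0 : EuclideanSpace ℝ (Fin n))}ᶜ) :
    ContDiffOn ℝ m (euclideanLaplacian g) {(0 : EuclideanSpace ℝ (Fin n))}ᶜ :=
  ContDiffOn.sum (fun i _ => cd_pd _ (cd_pd _ hg))

theorem da {m : WithTop ℕ∞} {g : EuclideanSpace ℝ (Fin n) → ℝ}
    (hg : ContDiffOn ℝ m g {(0 : EuclideanSpace ℝ (Fin n))}ᶜ) (hm : 1 ≤ m)
    {x : EuclideanSpace ℝ (Fin n)} (hx : x ≠ 0) : DifferentiableAt ℝ g x :=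
  (hg.contDiffAt (nhds_U hx)).differentiableAt (by rintro rfl; simp at hm)

theorem pd_congr {f g : EuclideanSpace ℝ (Fin n) → ℝ} (v : EuclideanSpace ℝ (Fin n))
    (h : ∀ y, y ≠ 0 → f y = g y) {x : EuclideanSpace ℝ (Fin n)} (hx : x ≠ 0) :
    pd v f x = pd v g x := by
  have : f =ᶠ[nhds x] g := by
    filter_upwards [nhds_U hx] with y hy using h y hy
  simp only [pd, this.fderiv_eq]

theorem lap_congr {f g : EuclideanSpace ℝ (Fin n) → ℝ}
    (h : ∀ y, y ≠ 0 → f y = g y) {x : EuclideanSpace ℝ (Fin n)} (hx : x ≠ 0) :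
    euclideanLaplacian f x = euclideanLaplacian g x := by
  simp only [lap_eq]
  exact Finset.sum_congr rfl fun i _ => pd_congr _ (fun y hy => pd_congr _ h hy) hx

theorem pd_lin {f g : EuclideanSpace ℝ (Fin n) → ℝ} (v : EuclideanSpace ℝ (Fin n)) (a b : ℝ)
    {x : EuclideanSpace ℝ (Fin n)} (hf : DifferentiableAt ℝ f x) (hg : DifferentiableAt ℝ g x) :
    pd v (fun y => a * f y + b * g y) x = a * pd v f x + b * pd v g x := by
  have := ((hf.hasFDerivAt.const_mul a).add (hg.hasFDerivAt.const_mul b)).fderiv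
  change fderiv ℝ ((fun y => a * f y) + fun y => b * g y) x v = _
  rw [this]; simp [pd]

theorem lap_lin {f g : EuclideanSpace ℝ (Fin n) → ℝ} (a b : ℝ)
    (hf : ContDiffOn ℝ 2 f {(0 : EuclideanSpace ℝ (Fin n))}ᶜ)
    (hg : ContDiffOn ℝ 2 g {(0 : EuclideanSpace ℝ (Fin n))}ᶜ)
    {x : EuclideanSpace ℝ (Fin n)} (hx : x ≠ 0) :
    euclideanLaplacian (fun y => a * f y + b * g y) x =
      a * euclideanLaplacian f x + b * euclideanLaplacian g x := by
  have h2 : (2 : WithTop ℕ∞) = 1 + 1 := by norm_num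
  simp only [lap_eq, Finset.mul_sum, ← Finset.sum_add_distrib]
  refine Finset.sum_congr rfl fun i _ => ?_
  rw [pd_congr _ (fun y hy => pd_lin _ a b (da hf (by norm_num) hy) (da hg (by norm_num) hy)) hx]
  exact pd_lin _ a b (da (cd_pd _ (h2 ▸ hf)) le_rfl hx) (da (cd_pd _ (h2 ▸ hg)) le_rfl hx)

theorem pd_eu {g : EuclideanSpace ℝ (Fin n) → ℝ} (v : EuclideanSpace ℝ (Fin n))
    (hg : ContDiffOn ℝ 2 g {(0 : EuclideanSpace ℝ (Fin n))}ᶜ)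
    {x : EuclideanSpace ℝ (Fin n)} (hx : x ≠ 0) :
    pd v (eu g) x = eu (pd v g) x + pd v g x := by
  have h2 : (2 : WithTop ℕ∞) = 1 + 1 := by norm_num
  have hG : DifferentiableAt ℝ (fderiv ℝ g) x :=
    ((cd_fderiv (h2 ▸ hg)).contDiffAt (nhds_U hx)).differentiableAt (by norm_num)
  have e1 := (hG.hasFDerivAt.clm_apply (hasFDerivAt_id x)).fderiv
  have e2 := (hG.hasFDerivAt.clm_apply (hasFDerivAt_const v x)).fderiv
  have sym := (hg.contDiffAt (nhds_U hx)).isSymmSndFDerivAt (by simp)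
  have e1' : pd v (eu g) x = fderiv ℝ g x v + fderiv ℝ (fderiv ℝ g) x v x := by
    change fderiv ℝ (fun y => fderiv ℝ g y (id y)) x v = _
    rw [e1]; simp
  have e2' : eu (pd v g) x = fderiv ℝ (fderiv ℝ g) x x v := by
    change fderiv ℝ (fun y => fderiv ℝ g y v) x x = _
    rw [e2]; simp
  rw [e1', e2', sym.eq v x, pd]; ring

theorem eu_lap {g : EuclideanSpace ℝ (Fin n) → ℝ}
    (hg : ContDiffOn ℝ 3 g {(0 : EuclideanSpace ℝ (Fin n))}ᶜ)
    {x : EuclideanSpace ℝ (Fin n)} (hx : x ≠ 0) :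
    euclideanLaplacian (eu g) x =
      eu (euclideanLaplacian g) x + 2 * euclideanLaplacian g x := by
  have h2 : (2 : WithTop ℕ∞) = 1 + 1 := by norm_num
  have h3 : (3 : WithTop ℕ∞) = 2 + 1 := by norm_num
  have hs : eu (euclideanLaplacian g) x =
      ∑ i : Fin n, eu (pd (EuclideanSpace.single i 1) (pd (EuclideanSpace.single i 1) g)) x := by
    have : euclideanLaplacian g = fun y =>
      ∑ i : Fin n, (pd (EuclideanSpace.single i 1) (pd (EuclideanSpace.single i 1) g)) y := rfl
    rw [eu, this, fderiv_fun_sum]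
    · simp [eu]
    · intro i _
      refine da (m := 1) (cd_pd _ (h2 ▸ cd_pd _ (h3 ▸ hg))) le_rfl hx
  rw [hs]
  simp only [lap_eq, Finset.mul_sum, ← Finset.sum_add_distrib]
  refine Finset.sum_congr rfl fun i _ => ?_
  set v : EuclideanSpace ℝ (Fin n) := EuclideanSpace.single i 1
  have hp : ContDiffOn ℝ 2 (pd v g) {(0 : EuclideanSpace ℝ (Fin n))}ᶜ := cd_pd _ (h3 ▸ hg)
  have := pd_lin v 1 1 (da (m := 1) (cd_eu (h2 ▸ hp)) le_rfl hx) (da hp (by norm_num) hx)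
  rw [pd_congr (g := fun y => 1 * eu (pd v g) y + 1 * pd v g y) v
    (fun y hy => by rw [pd_eu v (hg.of_le (by norm_num)) hy]; ring) hx, this, pd_eu v hp hx]
  ring

theorem hasFDerivAt_norm_rpow' (a : ℝ) {x : EuclideanSpace ℝ (Fin n)} (hx : x ≠ 0) :
    HasFDerivAt (fun y : EuclideanSpace ℝ (Fin n) => ‖y‖ ^ a)
      ((a * ‖x‖ ^ (a - 2)) • innerSL ℝ x) x := by
  have hp : 0 < ‖x‖ := norm_pos_iff.2 hx
  have h := (hasStrictFDerivAt_norm_sq x).hasFDerivAt.rpow_const (p := a / 2)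
    (Or.inl (by positivity))
  have hf : (fun y : EuclideanSpace ℝ (Fin n) => (‖y‖ ^ 2) ^ (a / 2)) = fun y => ‖y‖ ^ a := by
    funext y
    rw [← Real.rpow_natCast, ← Real.rpow_mul (norm_nonneg _)]
    congr 1; push_cast; ring
  rw [hf] at h
  refine h.congr_fderiv ?_
  rw [← Real.rpow_natCast, ← Real.rpow_mul hp.le]
  ext v
  simp
  rw [show (2 : ℝ) * (a / 2 - 1) = a - 2 by ring]
  ring

theorem hasFDerivAt_inv' {x : EuclideanSpace ℝ (Fin n)} (hx : x ≠ 0) :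
    HasFDerivAt (fun y : EuclideanSpace ℝ (Fin n) => (‖y‖ ^ 2)⁻¹ • y)
      ((‖x‖ ^ 2)⁻¹ • ContinuousLinearMap.id ℝ (EuclideanSpace ℝ (Fin n)) +
        ((-2 * ‖x‖ ^ (-4 : ℝ)) • innerSL ℝ x).smulRight x) x := by
  have h := (hasFDerivAt_norm_rpow' (-2) hx).smul (hasFDerivAt_id x)
  have hf : ∀ y : EuclideanSpace ℝ (Fin n), ‖y‖ ^ (-2 : ℝ) = (‖y‖ ^ 2)⁻¹ := by
    intro y
    rw [Real.rpow_neg (norm_nonneg _)]; norm_cast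
  have e : (fun y : EuclideanSpace ℝ (Fin n) => (‖y‖ ^ 2)⁻¹ • y) =
    (fun y : EuclideanSpace ℝ (Fin n) => ‖y‖ ^ (-2 : ℝ)) • id := by
    funext y; simp [hf]
  rw [e, ← hf]
  rw [show (-2 : ℝ) - 2 = -4 by norm_num] at h
  exact h

theorem tr_fderiv (a : ℝ) {g : EuclideanSpace ℝ (Fin n) → ℝ} {x : EuclideanSpace ℝ (Fin n)}
    (hx : x ≠ 0) (hg : DifferentiableAt ℝ g ((‖x‖^2)⁻¹ • x)) :
    DifferentiableAt ℝ (tr a g) x ∧ ∀ v, pd v (tr a g) x =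
      inner ℝ x v * tr (a-2) (fun y => a * g y + (-2) * eu g y) x + tr (a-2) (pd v g) x := by
  have hp : 0 < ‖x‖ := norm_pos_iff.2 hx
  have h := (hasFDerivAt_norm_rpow' a hx).mul (HasFDerivAt.comp (f := fun y : EuclideanSpace ℝ (Fin n) => (‖y‖ ^ 2)⁻¹ • y) x
    hg.hasFDerivAt (hasFDerivAt_inv' hx))
  refine ⟨h.differentiableAt, fun v => ?_⟩
  have h' := h.fderiv
  change fderiv ℝ ((fun y => ‖y‖ ^ a) * (g ∘ fun y => (‖y‖ ^ 2)⁻¹ • y)) x v = _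
  rw [h']
  have e1 : ‖x‖ ^ a = ‖x‖ ^ (a-2) * ‖x‖^2 := by
    rw [← Real.rpow_natCast, ← Real.rpow_add hp]; congr 1; push_cast; ring
  have e2 : ‖x‖ ^ (-4 : ℝ) = (‖x‖^2)⁻¹ * (‖x‖^2)⁻¹ := by
    rw [Real.rpow_neg hp.le]; norm_cast; rw [← mul_inv]; ring
  simp [tr, eu, pd, e1, e2]
  field_simp
  ring

theorem sum_inner (x : EuclideanSpace ℝ (Fin n)) (L : EuclideanSpace ℝ (Fin n) →L[ℝ] ℝ) :
    ∑ i : Fin n, inner ℝ x (EuclideanSpace.single i (1:ℝ)) * L (EuclideanSpace.single i 1)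
      = L x := by
  have := (EuclideanSpace.basisFun (Fin n) ℝ).sum_repr x
  conv_rhs => rw [← this]
  simp [EuclideanSpace.inner_single_right]

theorem sum_inner_sq (x : EuclideanSpace ℝ (Fin n)) :
    ∑ i : Fin n, inner ℝ x (EuclideanSpace.single i (1:ℝ)) *
      inner ℝ x (EuclideanSpace.single i (1:ℝ)) = ‖x‖^2 := by
  have := sum_inner x (innerSL ℝ x)
  simpa using this

theorem lap_tr (a : ℝ) {g : EuclideanSpace ℝ (Fin n) → ℝ}
    (hg : ContDiffOn ℝ 2 g {(0 : EuclideanSpace ℝ (Fin n))}ᶜ)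
    {x : EuclideanSpace ℝ (Fin n)} (hx : x ≠ 0) :
    euclideanLaplacian (tr a g) x = tr (a-4) (euclideanLaplacian g) x +
      (n + a - 2) * tr (a-2) (fun y => a * g y + (-2) * eu g y) x := by
  have h2 : (2 : WithTop ℕ∞) = 1 + 1 := by norm_num
  have hp : 0 < ‖x‖ := norm_pos_iff.2 hx
  set h : EuclideanSpace ℝ (Fin n) → ℝ := fun y => a * g y + (-2) * eu g y with hh
  have hgd : ∀ {y : EuclideanSpace ℝ (Fin n)}, y ≠ 0 → DifferentiableAt ℝ g y :=
    fun hy => da hg (by norm_num) hy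
  have hed : ∀ {y : EuclideanSpace ℝ (Fin n)}, y ≠ 0 → DifferentiableAt ℝ (eu g) y :=
    fun hy => da (m := 1) (cd_eu (h2 ▸ hg)) le_rfl hy
  have hhd : ∀ {y : EuclideanSpace ℝ (Fin n)}, y ≠ 0 → DifferentiableAt ℝ h y :=
    fun hy => ((hgd hy).const_mul a).add ((hed hy).const_mul (-2))
  have key : ∀ v : EuclideanSpace ℝ (Fin n), pd v (pd v (tr a g)) x =
      inner ℝ v v * tr (a-2) h x
      + (inner ℝ x v * inner ℝ x v) * tr (a-4) (fun y => (a-2) * h y + (-2) * eu h y) x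
      + 2 * ‖x‖^(a-4) * (inner ℝ x v * fderiv ℝ h ((‖x‖^2)⁻¹ • x) v)
      + tr (a-4) (pd v (pd v g)) x := by
    intro v
    have hpd : ∀ {y : EuclideanSpace ℝ (Fin n)}, y ≠ 0 → DifferentiableAt ℝ (pd v g) y :=
      fun hy => da (m := 1) (cd_pd v (h2 ▸ hg)) le_rfl hy
    rw [pd_congr v (fun y hy => (tr_fderiv a hy (hgd (inv_ne hy))).2 v) hx]
    obtain ⟨d1, f1⟩ := tr_fderiv (a-2) hx (hhd (inv_ne hx))
    obtain ⟨d2, f2⟩ := tr_fderiv (a-2) hx (hpd (inv_ne hx))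
    have hi : HasFDerivAt (fun y : EuclideanSpace ℝ (Fin n) => (inner ℝ y v : ℝ))
        (innerSL ℝ v) x := by
      have := (innerSL ℝ v).hasFDerivAt (x := x)
      refine this.congr_of_eventuallyEq (Filter.Eventually.of_forall fun y => ?_)
      simp [real_inner_comm]
    have e := ((hi.mul d1.hasFDerivAt).add d2.hasFDerivAt).fderiv
    have e' : pd v (fun y => inner ℝ y v * tr (a-2) h y + tr (a-2) (pd v g) y) x =
        inner ℝ x v * pd v (tr (a-2) h) x + tr (a-2) h x * inner ℝ v v
          + pd v (tr (a-2) (pd v g)) x := by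
      change fderiv ℝ ((fun y => inner ℝ y v) * (tr (a-2) h) + tr (a-2) (pd v g)) x v = _
      rw [e]; simp [pd, -inner_self_eq_norm_sq_to_K]
    rw [e', f1, f2]
    have p1 := pd_eu v hg (inv_ne hx)
    have p2 := pd_lin v a (-2) (hgd (inv_ne hx)) (hed (inv_ne hx))
    rw [← hh] at p2
    rw [show a - 2 - 2 = a - 4 by ring]
    change _ = _ + _ + 2 * ‖x‖^(a-4) * (inner ℝ x v * pd v h ((‖x‖^2)⁻¹ • x)) + _
    simp only [tr] 
    rw [p2, p1]
    ring
  have hL : fderiv ℝ h ((‖x‖^2)⁻¹ • x) x = ‖x‖^2 * eu h ((‖x‖^2)⁻¹ • x) := by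
    simp only [eu, map_smul, smul_eq_mul]
    field_simp
  have e1 : ‖x‖ ^ (a-2) = ‖x‖ ^ (a-4) * ‖x‖^2 := by
    rw [← Real.rpow_natCast, ← Real.rpow_add hp]; congr 1; push_cast; ring
  rw [lap_eq]
  simp only [key, Finset.sum_add_distrib, ← Finset.sum_mul, ← Finset.mul_sum, sum_inner,
    sum_inner_sq, hL]
  have hs : ∑ i : Fin n, tr (a-4) (pd (EuclideanSpace.single i 1)
      (pd (EuclideanSpace.single i 1) g)) x = tr (a-4) (euclideanLaplacian g) x := by
    simp only [tr, lap_eq, Finset.mul_sum]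
  have hc : ∑ i : Fin n, inner ℝ (EuclideanSpace.single i (1:ℝ))
      (EuclideanSpace.single i (1:ℝ)) = (n : ℝ) := by
    simp
  rw [hs, hc]
  simp only [tr, e1]
  ring

end Kelvin

open Kelvin in
theorem stmt_12 (n : ℕ) (hn : 5 ≤ n) (u : EuclideanSpace ℝ (Fin n) → ℝ)
    (hu : ContDiffOn ℝ 4 u {(0 : EuclideanSpace ℝ (Fin n))}ᶜ) :
    ∀ x : EuclideanSpace ℝ (Fin n), x ≠ 0 →
      euclideanLaplacian
          (euclideanLaplacian (fun y => ‖y‖ ^ ((4 : ℝ) - (n : ℝ)) * u ((‖y‖^2)⁻¹ • y))) x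
        = ‖x‖ ^ (-((n : ℝ) + 4)) * euclideanLaplacian (euclideanLaplacian u) ((‖x‖^2)⁻¹ • x) := by
  intro x hx
  have hp : 0 < ‖x‖ := norm_pos_iff.2 hx
  change euclideanLaplacian (euclideanLaplacian (tr (4 - (n:ℝ)) u)) x = _
  have h3 : ContDiffOn ℝ 3 u {(0 : EuclideanSpace ℝ (Fin n))}ᶜ := hu.of_le (by norm_num)
  have h2 : ContDiffOn ℝ 2 u {(0 : EuclideanSpace ℝ (Fin n))}ᶜ := hu.of_le (by norm_num)
  have hl : ContDiffOn ℝ 2 (euclideanLaplacian u) {(0 : EuclideanSpace ℝ (Fin n))}ᶜ :=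
    cd_lap (hu.of_le (by norm_num))
  have he : ContDiffOn ℝ 2 (eu u) {(0 : EuclideanSpace ℝ (Fin n))}ᶜ :=
    cd_eu (h3.of_le (by norm_num))
  set h : EuclideanSpace ℝ (Fin n) → ℝ := fun y => (4 - (n:ℝ)) * u y + (-2) * eu u y with hh
  have hhc : ContDiffOn ℝ 2 h {(0 : EuclideanSpace ℝ (Fin n))}ᶜ :=
    (contDiffOn_const.mul h2).add (contDiffOn_const.mul he)
  -- the smoothness of the transforms
  have hI : ContDiffOn ℝ 2 (fun y : EuclideanSpace ℝ (Fin n) => (‖y‖^2)⁻¹ • y)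
      {(0 : EuclideanSpace ℝ (Fin n))}ᶜ :=
    ContDiffOn.smul (ContDiffOn.inv (contDiff_norm_sq ℝ).contDiffOn
      (fun y hy => by simpa using hy)) contDiffOn_id
  have htr : ∀ (a : ℝ) (g : EuclideanSpace ℝ (Fin n) → ℝ),
      ContDiffOn ℝ 2 g {(0 : EuclideanSpace ℝ (Fin n))}ᶜ →
      ContDiffOn ℝ 2 (tr a g) {(0 : EuclideanSpace ℝ (Fin n))}ᶜ := by
    intro a g hg
    refine ContDiffOn.mul ?_ (hg.comp hI fun y hy => inv_ne hy)
    exact ContDiffOn.rpow_const_of_ne (contDiffOn_id.norm ℝ fun y hy => hy)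
      (fun y hy => by simpa using hy)
  rw [lap_congr (g := fun y => 1 * tr (-(n:ℝ)) (euclideanLaplacian u) y
      + 2 * tr (2 - (n:ℝ)) h y) (fun y hy => ?_) hx]
  · rw [lap_lin 1 2 (htr _ _ hl) (htr _ _ hhc) hx, lap_tr _ hl hx, lap_tr _ hhc hx]
    have hz := inv_ne hx
    simp only [tr]
    rw [lap_lin _ _ h2 he hz, eu_lap h3 hz]
    rw [show 2 - (n:ℝ) - 4 = -n - 2 by ring, show -((n:ℝ)+4) = -n - 4 by ring]
    ring
  · rw [lap_tr _ h2 hy, show 4 - (n:ℝ) - 4 = -n by ring, show 4 - (n:ℝ) - 2 = 2 - n by ring]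
    ring
end

section
/- Let n ≥ 5 be an integer and let u : ℝⁿ → ℝ be four times continuously differentiable and strictly positive on ℝⁿ∖{0}, satisfying Δ²u(x) = (n(n²−4)(n−4)/16)·u(x)^((n+4)/(n−4)) for every x ≠ 0. Then its Kelvin transform K(u)(x) = ‖x‖^(4−n)·u(x/‖x‖²) is strictly positive on ℝⁿ∖{0} and satisfies the same equation there: Δ²(K(u))(x) = (n(n²−4)(n−4)/16)·(K(u)(x))^((n+4)/(n−4)) for every x ≠ 0. -/
section Kelvin

open Finset

variable {n : ℕ}

/-- partial derivative -/
noncomputable def kvD (i : Fin n) (f : EuclideanSpace ℝ (Fin n) → ℝ) :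
    EuclideanSpace ℝ (Fin n) → ℝ :=
  fun y => fderiv ℝ f y (EuclideanSpace.single i 1)

/-- Euler operator -/
noncomputable def kvE (f : EuclideanSpace ℝ (Fin n) → ℝ) :
    EuclideanSpace ℝ (Fin n) → ℝ :=
  fun y => ∑ j, y j * kvD j f y

/-- weighted inversion -/
noncomputable def kvK (a : ℝ) (f : EuclideanSpace ℝ (Fin n) → ℝ) :
    EuclideanSpace ℝ (Fin n) → ℝ :=
  fun y => ‖y‖ ^ a * f ((‖y‖^2)⁻¹ • y)

/-- regularity away from the origin -/
def kvC (k : ℕ) (f : EuclideanSpace ℝ (Fin n) → ℝ) : Prop :=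
  ∀ x, x ≠ 0 → ContDiffAt ℝ k f x

lemma kv_lap (f : EuclideanSpace ℝ (Fin n) → ℝ) (x) :
    euclideanLaplacian f x = ∑ i, kvD i (kvD i f) x := rfl

lemma kvC.mono {k m : ℕ} {f : EuclideanSpace ℝ (Fin n) → ℝ} (h : kvC k f) (hm : m ≤ k) :
    kvC m f := fun x hx => (h x hx).of_le (by exact_mod_cast hm)

lemma kvC.diff {k : ℕ} {f : EuclideanSpace ℝ (Fin n) → ℝ} (h : kvC (k+1) f) {x} (hx : x ≠ 0) :
    DifferentiableAt ℝ f x := (h x hx).differentiableAt (by simp)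

lemma kvC.D {k : ℕ} {f : EuclideanSpace ℝ (Fin n) → ℝ} (h : kvC (k+1) f) (i : Fin n) :
    kvC k (kvD i f) := fun x hx =>
  ((h x hx).fderiv_right (m := k) (by push_cast; rfl)).clm_apply contDiffAt_const

lemma kv_coord_contDiff (k : ℕ) (j : Fin n) :
    ContDiff ℝ k (fun y : EuclideanSpace ℝ (Fin n) => y j) := by
  fun_prop

lemma kvC.sum {k : ℕ} {f : Fin n → EuclideanSpace ℝ (Fin n) → ℝ} (h : ∀ i, kvC k (f i)) :
    kvC k (fun y => ∑ i, f i y) := fun x hx => ContDiffAt.sum fun i _ => h i x hx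

lemma kvC.coord_mul {k : ℕ} {f : EuclideanSpace ℝ (Fin n) → ℝ} (h : kvC k f) (j : Fin n) :
    kvC k (fun y => y j * f y) := fun x hx => (kv_coord_contDiff k j).contDiffAt.mul (h x hx)

lemma kvC.E {k : ℕ} {f : EuclideanSpace ℝ (Fin n) → ℝ} (h : kvC (k+1) f) :
    kvC k (kvE f) := kvC.sum fun i => (h.D i).coord_mul i

lemma kvC.add {k : ℕ} {f g : EuclideanSpace ℝ (Fin n) → ℝ} (h : kvC k f) (hg : kvC k g) :
    kvC k (fun y => f y + g y) := fun x hx => (h x hx).add (hg x hx)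

lemma kvC.cmul {k : ℕ} {f : EuclideanSpace ℝ (Fin n) → ℝ} (h : kvC k f) (c : ℝ) :
    kvC k (fun y => c * f y) := fun x hx => contDiffAt_const.mul (h x hx)

lemma kvC.K {k : ℕ} {f : EuclideanSpace ℝ (Fin n) → ℝ} (h : kvC k f) (a : ℝ) :
    kvC k (kvK a f) := fun x hx => by
  have h0 : ‖x‖ ≠ 0 := by simpa using hx
  have hn : ContDiffAt ℝ k (fun y : EuclideanSpace ℝ (Fin n) => ‖y‖) x := contDiffAt_norm ℝ hx
  have h1 : ContDiffAt ℝ k (fun y : EuclideanSpace ℝ (Fin n) => (‖y‖^2)⁻¹ • y) x :=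
    ((hn.pow 2).inv (by positivity)).smul contDiffAt_id
  refine (hn.rpow_const_of_ne h0).mul ?_
  exact ContDiffAt.comp x (h _ (by simp [hx])) h1

lemma kvD_congr {f g : EuclideanSpace ℝ (Fin n) → ℝ} (h : ∀ x, x ≠ 0 → f x = g x) (i : Fin n) :
    ∀ x, x ≠ 0 → kvD i f x = kvD i g x := fun x hx => by
  have : f =ᶠ[nhds x] g := by
    filter_upwards [isOpen_ne.mem_nhds hx] with y hy using h y hy
  simp [kvD, this.fderiv_eq]

lemma kvD_add {f g : EuclideanSpace ℝ (Fin n) → ℝ} (hf : kvC 1 f) (hg : kvC 1 g) (i : Fin n) {x}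
    (hx : x ≠ 0) : kvD i (fun y => f y + g y) x = kvD i f x + kvD i g x := by
  simp [kvD, fderiv_fun_add (hf.diff (k := 0) hx) (hg.diff (k := 0) hx)]

lemma kvD_cmul {f : EuclideanSpace ℝ (Fin n) → ℝ} (hf : kvC 1 f) (c : ℝ) (i : Fin n) {x}
    (hx : x ≠ 0) : kvD i (fun y => c * f y) x = c * kvD i f x := by
  simp [kvD, fderiv_const_mul (hf.diff (k := 0) hx)]

lemma kvD_sum {f : Fin n → EuclideanSpace ℝ (Fin n) → ℝ} (hf : ∀ j, kvC 1 (f j)) (i : Fin n) {x}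
    (hx : x ≠ 0) : kvD i (fun y => ∑ j, f j y) x = ∑ j, kvD i (f j) x := by
  simp [kvD, fderiv_fun_sum (fun j _ => (hf j).diff (k := 0) hx)]

lemma kvD_coord (i j : Fin n) (x) :
    kvD i (fun y : EuclideanSpace ℝ (Fin n) => y j) x = if j = i then 1 else 0 := by
  have : HasFDerivAt (fun y : EuclideanSpace ℝ (Fin n) => y j)
      (EuclideanSpace.proj j : EuclideanSpace ℝ (Fin n) →L[ℝ] ℝ) x :=
    (EuclideanSpace.proj j : EuclideanSpace ℝ (Fin n) →L[ℝ] ℝ).hasFDerivAt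
  simp [kvD, this.fderiv]

lemma kvD_coord_mul {f : EuclideanSpace ℝ (Fin n) → ℝ} (hf : kvC 1 f) (i j : Fin n) {x}
    (hx : x ≠ 0) : kvD i (fun y => y j * f y) x =
      (if j = i then f x else 0) + x j * kvD i f x := by
  have h := kvD_coord i j x
  unfold kvD at h ⊢
  rw [fderiv_fun_mul ((kv_coord_contDiff 1 j).contDiffAt.differentiableAt (by simp))
    (hf.diff (k := 0) hx)]
  simp only [add_apply, smul_apply, smul_eq_mul, h]
  split_ifs <;> ring

lemma kvD_comm {f : EuclideanSpace ℝ (Fin n) → ℝ} (hf : kvC 2 f) (i j : Fin n) {x}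
    (hx : x ≠ 0) : kvD i (kvD j f) x = kvD j (kvD i f) x := by
  have hs : IsSymmSndFDerivAt ℝ f x := (hf x hx).isSymmSndFDerivAt (by simp)
  have hd : DifferentiableAt ℝ (fderiv ℝ f) x :=
    ((hf x hx).fderiv_right (m := 1) (by norm_num)).differentiableAt (by simp)
  have key : ∀ i j : Fin n, kvD i (kvD j f) x = fderiv ℝ (fderiv ℝ f) x
      (EuclideanSpace.single i 1) (EuclideanSpace.single j 1) := fun i j => by
    unfold kvD
    rw [fderiv_clm_apply hd (differentiableAt_const _)]
    simp
  rw [key, key]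
  exact hs.eq _ _

lemma kvD_E {f : EuclideanSpace ℝ (Fin n) → ℝ} (hf : kvC 2 f) (i : Fin n) {x}
    (hx : x ≠ 0) : kvD i (kvE f) x = kvD i f x + kvE (kvD i f) x := by
  have h1 : ∀ j, kvC 1 (kvD j f) := fun j => hf.D j
  unfold kvE
  rw [kvD_sum (fun j => (h1 j).coord_mul j) i hx]
  simp_rw [fun j => kvD_coord_mul (h1 j) i j hx, sum_add_distrib, fun j => kvD_comm hf i j hx]
  simp

lemma kvE_eq (f : EuclideanSpace ℝ (Fin n) → ℝ) (y) : kvE f y = fderiv ℝ f y y := by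
  have hy : y = ∑ j, y j • EuclideanSpace.single j (1:ℝ) := by
    ext k; simp [Pi.single_apply]
  conv_rhs => rw [hy, ← hy]
  conv_rhs => arg 2; rw [hy]
  simp only [map_sum, map_smul, smul_eq_mul]
  rfl

lemma kvD_K {f : EuclideanSpace ℝ (Fin n) → ℝ} (hf : kvC 1 f) (a : ℝ) (i : Fin n) {x}
    (hx : x ≠ 0) : kvD i (kvK a f) x =
      kvK (a-2) (kvD i f) x + x i * (a * kvK (a-2) f x - 2 * kvK (a-2) (kvE f) x) := by
  have h0 : 0 < ‖x‖ := norm_pos_iff.2 hx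
  have hsq : HasFDerivAt (fun y : EuclideanSpace ℝ (Fin n) => ‖y‖^2) (2 • innerSL ℝ x) x :=
    (hasStrictFDerivAt_norm_sq x).hasFDerivAt
  have hinv : HasFDerivAt (fun y : EuclideanSpace ℝ (Fin n) => (‖y‖^2)⁻¹) _ x :=
    (hasDerivAt_inv (x := ‖x‖^2) (by positivity)).comp_hasFDerivAt x hsq
  have hphi : HasFDerivAt (fun y : EuclideanSpace ℝ (Fin n) => (‖y‖^2)⁻¹ • y) _ x :=
    hinv.smul (hasFDerivAt_id x)
  have hpow : HasFDerivAt (fun y : EuclideanSpace ℝ (Fin n) => (‖y‖^2)^(a/2)) _ x :=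
    hsq.rpow_const (Or.inl (by positivity))
  have hf' : HasFDerivAt f (fderiv ℝ f ((‖x‖^2)⁻¹ • x)) ((‖x‖^2)⁻¹ • x) :=
    (hf.diff (k := 0) (by simp [hx])).hasFDerivAt
  have hcomp : HasFDerivAt (fun y : EuclideanSpace ℝ (Fin n) => f ((‖y‖^2)⁻¹ • y)) _ x :=
    HasFDerivAt.comp (f := fun y : EuclideanSpace ℝ (Fin n) => (‖y‖^2)⁻¹ • y) x hf' hphi
  have hall := hpow.fun_mul hcomp
  have hr : ∀ (b : ℝ) (y : EuclideanSpace ℝ (Fin n)), (‖y‖^2)^(b/2) = ‖y‖^b := fun b y => by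
    rw [← Real.rpow_natCast, ← Real.rpow_mul (norm_nonneg y)]; congr 1; push_cast; ring
  have hfun : kvK a f = fun y => (‖y‖^2)^(a/2) * f ((‖y‖^2)⁻¹ • y) := by
    funext y; simp [kvK, hr]
  have e1 : (‖x‖^2)^(a/2 - 1) = ‖x‖^(a-2) := by
    rw [← hr (a-2)]; congr 1; ring
  have e2 : ‖x‖^a = ‖x‖^(a-2) * ‖x‖^2 := by
    rw [← Real.rpow_natCast, ← Real.rpow_add h0]; congr 1; push_cast; ring
  have hinner : inner ℝ x (EuclideanSpace.single i (1:ℝ)) = x i := by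
    rw [EuclideanSpace.inner_single_right]; simp
  have hD : kvD i (kvK a f) x = fderiv ℝ (kvK a f) x (EuclideanSpace.single i 1) := rfl
  rw [hD, hfun, HasFDerivAt.fderiv hall]
  simp only [kvK, kvE_eq, kvD]
  generalize fderiv ℝ f ((‖x‖^2)⁻¹ • x) = L
  simp only [add_apply, smul_apply, ContinuousLinearMap.comp_apply,
    ContinuousLinearMap.id_apply, ContinuousLinearMap.smulRight_apply, innerSL_apply_apply, hinner,
    map_add, map_smul, smul_eq_mul, nsmul_eq_mul, hr, e1, e2]
  field_simp
  ring

/-- auxiliary first-order combination -/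
noncomputable def kvH (a : ℝ) (f : EuclideanSpace ℝ (Fin n) → ℝ) :
    EuclideanSpace ℝ (Fin n) → ℝ := fun y => a * f y + (-2) * kvE f y

lemma kvD_K' {f : EuclideanSpace ℝ (Fin n) → ℝ} (hf : kvC 1 f) (a : ℝ) (i : Fin n) {x}
    (hx : x ≠ 0) : kvD i (kvK a f) x =
      kvK (a-2) (kvD i f) x + x i * kvK (a-2) (kvH a f) x := by
  rw [kvD_K hf a i hx]; simp only [kvK, kvH]; ring

lemma kvH_C {k : ℕ} {f : EuclideanSpace ℝ (Fin n) → ℝ} (hf : kvC (k+1) f) (a : ℝ) :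
    kvC k (kvH a f) := ((hf.mono (by omega)).cmul a).add (hf.E.cmul (-2))

lemma kvE_add {f g : EuclideanSpace ℝ (Fin n) → ℝ} (hf : kvC 1 f) (hg : kvC 1 g) {x}
    (hx : x ≠ 0) : kvE (fun y => f y + g y) x = kvE f x + kvE g x := by
  simp only [kvE, kvD_add hf hg _ hx, mul_add, sum_add_distrib]

lemma kvE_cmul {f : EuclideanSpace ℝ (Fin n) → ℝ} (hf : kvC 1 f) (c : ℝ) {x}
    (hx : x ≠ 0) : kvE (fun y => c * f y) x = c * kvE f x := by
  simp only [kvE, kvD_cmul hf c _ hx, mul_sum]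
  exact sum_congr rfl fun _ _ => by ring

lemma kvE_congr {f g : EuclideanSpace ℝ (Fin n) → ℝ} (h : ∀ x, x ≠ 0 → f x = g x) {x}
    (hx : x ≠ 0) : kvE f x = kvE g x := by
  simp only [kvE, kvD_congr h _ x hx]

lemma kvE_sum {f : Fin n → EuclideanSpace ℝ (Fin n) → ℝ} (hf : ∀ j, kvC 1 (f j)) {x}
    (hx : x ≠ 0) : kvE (fun y => ∑ j, f j y) x = ∑ j, kvE (f j) x := by
  simp only [kvE, kvD_sum hf _ hx, mul_sum]
  exact sum_comm

lemma kvlap_C {k : ℕ} {f : EuclideanSpace ℝ (Fin n) → ℝ} (hf : kvC (k+2) f) :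
    kvC k (euclideanLaplacian f) := kvC.sum fun i => (hf.D (k := k+1) i).D i

lemma kvlap_congr {f g : EuclideanSpace ℝ (Fin n) → ℝ} (h : ∀ x, x ≠ 0 → f x = g x) {x}
    (hx : x ≠ 0) : euclideanLaplacian f x = euclideanLaplacian g x := by
  simp only [kv_lap, kvD_congr (kvD_congr h _) _ x hx]

lemma kvlap_add {f g : EuclideanSpace ℝ (Fin n) → ℝ} (hf : kvC 2 f) (hg : kvC 2 g) {x}
    (hx : x ≠ 0) : euclideanLaplacian (fun y => f y + g y) x
      = euclideanLaplacian f x + euclideanLaplacian g x := by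
  simp only [kv_lap, ← sum_add_distrib]
  refine sum_congr rfl fun i _ => ?_
  rw [kvD_congr (fun y hy => kvD_add (hf.mono (by norm_num)) (hg.mono (by norm_num)) i hy) i x hx,
    kvD_add (hf.D i) (hg.D i) i hx]

lemma kvlap_cmul {f : EuclideanSpace ℝ (Fin n) → ℝ} (hf : kvC 2 f) (c : ℝ) {x}
    (hx : x ≠ 0) : euclideanLaplacian (fun y => c * f y) x = c * euclideanLaplacian f x := by
  simp only [kv_lap, mul_sum]
  refine sum_congr rfl fun i _ => ?_
  rw [kvD_congr (fun y hy => kvD_cmul (hf.mono (by norm_num)) c i hy) i x hx,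
    kvD_cmul (hf.D i) c i hx]

lemma kvlap_E {f : EuclideanSpace ℝ (Fin n) → ℝ} (hf : kvC 3 f) {x}
    (hx : x ≠ 0) : euclideanLaplacian (kvE f) x
      = 2 * euclideanLaplacian f x + kvE (euclideanLaplacian f) x := by
  have h1 : kvE (euclideanLaplacian f) x = ∑ i, kvE (kvD i (kvD i f)) x :=
    kvE_sum (fun i => (hf.D (k := 2) i).D i) hx
  rw [h1]
  simp only [kv_lap, mul_sum, ← sum_add_distrib]
  refine sum_congr rfl fun i _ => ?_
  have h2 : kvC 2 (kvD i f) := hf.D i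
  rw [kvD_congr (fun y hy => kvD_E (hf.mono (by norm_num)) i hy) i x hx,
    kvD_add (h2.mono (by norm_num)) h2.E i hx, kvD_E h2 i hx]
  ring

lemma kv_inv_ne {x : EuclideanSpace ℝ (Fin n)} (hx : x ≠ 0) : (‖x‖^2)⁻¹ • x ≠ 0 := by
  simp [hx]

lemma kv_pow (b : ℝ) {x : EuclideanSpace ℝ (Fin n)} (hx : x ≠ 0) :
    ‖x‖^(b+2) = ‖x‖^b * ‖x‖^2 := by
  rw [← Real.rpow_natCast, ← Real.rpow_add (norm_pos_iff.2 hx)]; norm_num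

lemma kvK_sum_D (b : ℝ) (F : EuclideanSpace ℝ (Fin n) → ℝ) {x} (hx : x ≠ 0) :
    ∑ i, x i * kvK b (kvD i F) x = kvK (b+2) (kvE F) x := by
  have h0 : ‖x‖ ≠ 0 := by simpa using hx
  simp only [kvK, kvE, kv_pow b hx, mul_sum]
  refine sum_congr rfl fun i _ => ?_
  simp only [PiLp.smul_apply, smul_eq_mul]
  field_simp

lemma kvlap_K {f : EuclideanSpace ℝ (Fin n) → ℝ} (hf : kvC 2 f) (a : ℝ) {x} (hx : x ≠ 0) :
    euclideanLaplacian (kvK a f) x = kvK (a-4) (euclideanLaplacian f) x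
      + (-2*(n-2) - 2*a) * kvK (a-2) (kvE f) x + a*(a+n-2) * kvK (a-2) f x := by
  have hf1 : kvC 1 f := hf.mono (by norm_num)
  have hH : kvC 1 (kvH a f) := kvH_C hf a
  have hE : kvC 1 (kvE f) := hf.E
  have hφ := kv_inv_ne hx
  have key : ∀ i, kvD i (kvD i (kvK a f)) x = kvK (a-4) (kvD i (kvD i f)) x
      + (a * (x i * kvK (a-4) (kvD i f) x) - 2 * (x i * kvK (a-4) (kvD i (kvE f)) x))
      + kvK (a-2) (kvH a f) x
      + (x i * kvK (a-4) (kvD i (kvH a f)) x + (x i)^2 * kvK (a-4) (kvH (a-2) (kvH a f)) x) := by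
    intro i
    have e4 : a - 2 - 2 = a - 4 := by ring
    rw [kvD_congr (fun y hy => kvD_K' hf1 a i hy) i x hx,
      kvD_add ((hf.D i).K _) ((hH.K _).coord_mul i) i hx, kvD_K' (hf.D i) _ i hx,
      kvD_coord_mul (hH.K _) i i hx, kvD_K' hH _ i hx, e4]
    have : kvK (a-4) (kvH (a-2) (kvD i f)) x
        = a * kvK (a-4) (kvD i f) x - 2 * kvK (a-4) (kvD i (kvE f)) x := by
      simp only [kvK, kvH, kvD_E hf i hφ]
      ring
    rw [this]
    simp only [if_true]
    ring
  have hs : ∑ i, (x i)^2 = ‖x‖^2 := by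
    rw [EuclideanSpace.norm_sq_eq]; simp
  have hl : ∑ i, kvK (a-4) (kvD i (kvD i f)) x = kvK (a-4) (euclideanLaplacian f) x := by
    simp only [kvK, kv_lap, mul_sum]
  have hp : ‖x‖^(a-2) = ‖x‖^(a-4) * ‖x‖^2 := by
    rw [← kv_pow _ hx]; congr 1; ring
  have e2 : a - 4 + 2 = a - 2 := by ring
  have hEH : kvE (kvH a f) ((‖x‖^2)⁻¹ • x) = a * kvE f ((‖x‖^2)⁻¹ • x)
      + (-2) * kvE (kvE f) ((‖x‖^2)⁻¹ • x) := by
    unfold kvH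
    rw [kvE_add (hf1.cmul a) (hE.cmul (-2)) hφ, kvE_cmul hf1 _ hφ, kvE_cmul hE _ hφ]
  rw [kv_lap]
  simp only [key, sum_add_distrib, sum_sub_distrib, ← mul_sum, ← sum_mul, kvK_sum_D _ _ hx, hs, hl,
    e2, sum_const, card_univ, Fintype.card_fin, nsmul_eq_mul]
  have hz : ‖x‖^2 * kvK (a-4) (kvH (a-2) (kvH a f)) x = kvK (a-2) (kvH (a-2) (kvH a f)) x := by
    simp only [kvK, hp]; ring
  rw [hz]
  simp only [kvK, kvH.eq_def (a-2), hEH]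
  simp only [kvH]
  ring

lemma kv_bilap {f : EuclideanSpace ℝ (Fin n) → ℝ} (hf : kvC 4 f) {x} (hx : x ≠ 0) :
    euclideanLaplacian (euclideanLaplacian (kvK (4-n) f)) x
      = kvK (-n-4) (euclideanLaplacian (euclideanLaplacian f)) x := by
  have hg : kvC 2 (euclideanLaplacian f) := kvlap_C hf
  have hf2 : kvC 2 f := hf.mono (by norm_num)
  have hf3 : kvC 3 f := hf.mono (by norm_num)
  have hE : kvC 2 (kvE f) := hf3.E
  have hφ := kv_inv_ne hx
  have h1 : ∀ y, y ≠ 0 → euclideanLaplacian (kvK (4-n) f) y =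
      kvK (-n) (euclideanLaplacian f) y
        + kvK (2-n) (fun z => (-4) * kvE f z + (2*(4-n)) * f z) y := by
    intro y hy
    rw [kvlap_K hf2 _ hy, show (4 - n - 4 : ℝ) = -n by ring, show (4 - n - 2 : ℝ) = 2 - n by ring]
    simp only [kvK]; ring
  have hh : kvC 2 (fun z => (-4) * kvE f z + (2*(4-n:ℝ)) * f z) :=
    (hE.cmul _).add (hf2.cmul _)
  rw [kvlap_congr h1 hx, kvlap_add (hg.K _) (hh.K _) hx, kvlap_K hg _ hx, kvlap_K hh _ hx,
    show (2 - n - 4 : ℝ) = -n-2 by ring]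
  have h2 := kvlap_add (hE.cmul (-4)) (hf2.cmul (2*(4-n:ℝ))) hφ
  rw [kvlap_cmul hE _ hφ, kvlap_cmul hf2 _ hφ, kvlap_E hf3 hφ] at h2
  simp only [kvK, h2]
  ring

end Kelvin


/-- If `u` is a positive `C⁴` solution of
`Δ²u = (n(n²-4)(n-4)/16)·u^((n+4)/(n-4))` on `ℝⁿ∖{0}`, then its Kelvin transform
`K(u)(x) = ‖x‖^(4-n)·u(x/‖x‖²)` is positive on `ℝⁿ∖{0}` and solves the same equation there. -/
theorem stmt_13 (n : ℕ) (hn : 5 ≤ n) (u : EuclideanSpace ℝ (Fin n) → ℝ)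
    (hu : ContDiffOn ℝ 4 u {(0 : EuclideanSpace ℝ (Fin n))}ᶜ)
    (hpos : ∀ x : EuclideanSpace ℝ (Fin n), x ≠ 0 → 0 < u x)
    (heq : ∀ x : EuclideanSpace ℝ (Fin n), x ≠ 0 →
      euclideanLaplacian (euclideanLaplacian u) x
        = ((n : ℝ) * ((n : ℝ)^2 - 4) * ((n : ℝ) - 4) / 16)
            * (u x) ^ (((n : ℝ) + 4)/((n : ℝ) - 4))) :
    (∀ x : EuclideanSpace ℝ (Fin n), x ≠ 0 →
      0 < ‖x‖ ^ ((4 : ℝ) - (n : ℝ)) * u ((‖x‖^2)⁻¹ • x)) ∧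
    (∀ x : EuclideanSpace ℝ (Fin n), x ≠ 0 →
      euclideanLaplacian
          (euclideanLaplacian (fun y => ‖y‖ ^ ((4 : ℝ) - (n : ℝ)) * u ((‖y‖^2)⁻¹ • y))) x
        = ((n : ℝ) * ((n : ℝ)^2 - 4) * ((n : ℝ) - 4) / 16)
            * (‖x‖ ^ ((4 : ℝ) - (n : ℝ)) * u ((‖x‖^2)⁻¹ • x)) ^ (((n : ℝ) + 4)/((n : ℝ) - 4))) := by
  have hn' : (0:ℝ) < (n:ℝ) - 4 := by
    have : (5:ℝ) ≤ n := by exact_mod_cast hn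
    linarith
  have hC : kvC 4 u := fun x hx => hu.contDiffAt (isOpen_compl_singleton.mem_nhds hx)
  refine ⟨fun x hx => mul_pos (Real.rpow_pos_of_pos (norm_pos_iff.2 hx) _)
    (hpos _ (kv_inv_ne hx)), fun x hx => ?_⟩
  have h := kv_bilap hC hx
  have h0 : 0 < ‖x‖ := norm_pos_iff.2 hx
  unfold kvK at h
  rw [h, heq _ (kv_inv_ne hx), Real.mul_rpow (by positivity) (hpos _ (kv_inv_ne hx)).le,
    ← Real.rpow_mul h0.le, show ((4:ℝ) - n) * ((n+4)/(n-4)) = -n-4 by field_simp; ring]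
  ring
end

section
/- Let n ≥ 5 be an integer, let l be a natural number, and let p : ℝⁿ → ℝ be a smooth function that is harmonic on ℝⁿ (Δp = 0 everywhere) and positively homogeneous of degree l (p(c·x) = cˡ·p(x) for all c > 0 and x). Then for all real numbers a and b, the function w(x) = (a·‖x‖^(2−n−2l) + b·‖x‖^(4−n−2l))·p(x) is biharmonic on ℝⁿ∖{0}: Δ(Δw)(x) = 0 for every x ≠ 0. -/
theorem aux_rpow {n : ℕ} (s : ℝ) (x : EuclideanSpace ℝ (Fin n)) (hx : x ≠ 0) :
    HasFDerivAt (fun y : EuclideanSpace ℝ (Fin n) => ‖y‖ ^ s)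
      ((s * ‖x‖ ^ (s - 2)) • (innerSL ℝ x)) x := by
  have h0 : 0 < ‖x‖ := norm_pos_iff.mpr hx
  have h1 := (hasStrictFDerivAt_norm_sq x).hasFDerivAt.rpow_const (p := s / 2)
    (Or.inl (by positivity))
  have e : (fun y : EuclideanSpace ℝ (Fin n) => (‖y‖ ^ 2) ^ (s / 2)) = fun y => ‖y‖ ^ s := by
    funext y
    rw [← Real.rpow_natCast, ← Real.rpow_mul (norm_nonneg _)]
    congr 1; push_cast; ring
  rw [e] at h1
  refine h1.congr_fderiv ?_
  rw [← Real.rpow_natCast, ← Real.rpow_mul (norm_nonneg _)]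
  have : ((2 : ℕ) : ℝ) * (s / 2 - 1) = s - 2 := by push_cast; ring
  rw [this]
  ext v
  simp
  ring

theorem aux_euler {n : ℕ} (l : ℕ) (p : EuclideanSpace ℝ (Fin n) → ℝ)
    (hp : ContDiff ℝ (⊤ : ℕ∞) p)
    (hhom : ∀ c : ℝ, 0 < c → ∀ x : EuclideanSpace ℝ (Fin n), p (c • x) = c^l * p x)
    (x : EuclideanSpace ℝ (Fin n)) : fderiv ℝ p x x = l * p x := by
  have hd : DifferentiableAt ℝ p ((1 : ℝ) • x) := (hp.differentiable (by simp)) _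
  have h1 : HasDerivAt (fun c : ℝ => c • x) ((1 : ℝ) • x) 1 := (hasDerivAt_id (1 : ℝ)).smul_const x
  have h2 := hd.hasFDerivAt.comp_hasDerivAt (1 : ℝ) h1
  have h3 : HasDerivAt (fun c : ℝ => c ^ l * p x) ((l * 1 ^ (l - 1)) * p x) 1 :=
    (hasDerivAt_pow l (1 : ℝ)).mul_const _
  have h4 : (p ∘ fun c : ℝ => c • x) =ᶠ[nhds 1] fun c : ℝ => c ^ l * p x := by
    filter_upwards [lt_mem_nhds (zero_lt_one (α := ℝ))] with c hc
    exact hhom c hc x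
  have := (h2.congr_of_eventuallyEq h4.symm).unique h3
  simpa using this

theorem aux_sum {n : ℕ} (L : EuclideanSpace ℝ (Fin n) →L[ℝ] ℝ) (x : EuclideanSpace ℝ (Fin n)) :
    ∑ i, x i * L (EuclideanSpace.single i 1) = L x := by
  have h := (EuclideanSpace.basisFun (Fin n) ℝ).sum_repr x
  conv_rhs => rw [← h]
  simp [map_sum]

/-- First derivative of `r^s p`. -/
theorem aux_d1 {n : ℕ} (p : EuclideanSpace ℝ (Fin n) → ℝ)
    (hp : ContDiff ℝ (⊤ : ℕ∞) p) (a b s t : ℝ) (x : EuclideanSpace ℝ (Fin n)) (hx : x ≠ 0)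
    (i : Fin n) :
    fderiv ℝ (fun y => (a * ‖y‖ ^ s + b * ‖y‖ ^ t) * p y) x (EuclideanSpace.single i 1) =
      (a * ‖x‖ ^ s + b * ‖x‖ ^ t) * fderiv ℝ p x (EuclideanSpace.single i 1) +
      (a * s * ‖x‖ ^ (s - 2) + b * t * ‖x‖ ^ (t - 2)) * (x i * p x) := by
  have hd : DifferentiableAt ℝ p x := (hp.differentiable (by simp)) _
  have h := (((aux_rpow s x hx).const_mul a).add ((aux_rpow t x hx).const_mul b)).mul
    hd.hasFDerivAt
  have h' := h.fderiv
  have e := congrArg (fun L => L (EuclideanSpace.single i (1 : ℝ))) h'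
  refine Eq.trans e ?_
  simp [EuclideanSpace.inner_single_right]
  ring

theorem aux_lap {n : ℕ} (l : ℕ) (p : EuclideanSpace ℝ (Fin n) → ℝ)
    (hp : ContDiff ℝ (⊤ : ℕ∞) p)
    (hharm : ∀ x : EuclideanSpace ℝ (Fin n), euclideanLaplacian p x = 0)
    (hhom : ∀ c : ℝ, 0 < c → ∀ x : EuclideanSpace ℝ (Fin n), p (c • x) = c^l * p x)
    (a b s t : ℝ) (x : EuclideanSpace ℝ (Fin n)) (hx : x ≠ 0) :
    euclideanLaplacian (fun y => (a * ‖y‖ ^ s + b * ‖y‖ ^ t) * p y) x =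
      (a * (s * (s + n - 2 + 2 * l)) * ‖x‖ ^ (s - 2)
        + b * (t * (t + n - 2 + 2 * l)) * ‖x‖ ^ (t - 2)) * p x := by
  have key : ∀ i : Fin n,
      fderiv ℝ (fun y => fderiv ℝ (fun y => (a * ‖y‖ ^ s + b * ‖y‖ ^ t) * p y) y
        (EuclideanSpace.single i 1)) x (EuclideanSpace.single i 1) =
      (a * ‖x‖ ^ s + b * ‖x‖ ^ t) *
        fderiv ℝ (fun y => fderiv ℝ p y (EuclideanSpace.single i 1)) x (EuclideanSpace.single i 1)
      + 2 * (a * s * ‖x‖ ^ (s - 2) + b * t * ‖x‖ ^ (t - 2)) *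
        (x i * fderiv ℝ p x (EuclideanSpace.single i 1))
      + (a * s * ‖x‖ ^ (s - 2) + b * t * ‖x‖ ^ (t - 2)) * p x
      + (a * s * (s - 2) * ‖x‖ ^ (s - 2 - 2) + b * t * (t - 2) * ‖x‖ ^ (t - 2 - 2)) * p x
        * (x i * x i) := by
    intro i
    have hev : (fun y => fderiv ℝ (fun y => (a * ‖y‖ ^ s + b * ‖y‖ ^ t) * p y) y
        (EuclideanSpace.single i 1)) =ᶠ[nhds x] fun y =>
        (a * ‖y‖ ^ s + b * ‖y‖ ^ t) * fderiv ℝ p y (EuclideanSpace.single i 1) +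
      (a * s * ‖y‖ ^ (s - 2) + b * t * ‖y‖ ^ (t - 2)) * (y i * p y) := by
      filter_upwards [isOpen_ne.mem_nhds hx] with y hy
      exact aux_d1 p hp a b s t y hy i
    rw [hev.fderiv_eq]
    have hd : DifferentiableAt ℝ p x := (hp.differentiable (by simp)) _
    have hd2 : DifferentiableAt ℝ (fun y => fderiv ℝ p y (EuclideanSpace.single i 1)) x := by
      have : ContDiff ℝ 1 (fderiv ℝ p) := hp.fderiv_right (by norm_cast)
      exact ((this.differentiable (by simp)) x).clm_apply (differentiableAt_const _)
    have hc : HasFDerivAt (fun y : EuclideanSpace ℝ (Fin n) => y i)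
      (EuclideanSpace.proj i : EuclideanSpace ℝ (Fin n) →L[ℝ] ℝ) x :=
      (EuclideanSpace.proj i : EuclideanSpace ℝ (Fin n) →L[ℝ] ℝ).hasFDerivAt
    have h := ((((aux_rpow s x hx).const_mul a).add ((aux_rpow t x hx).const_mul b)).mul
      hd2.hasFDerivAt).add
      ((((aux_rpow (s - 2) x hx).const_mul (a * s)).add
        ((aux_rpow (t - 2) x hx).const_mul (b * t))).mul (hc.mul hd.hasFDerivAt))
    have e := congrArg (fun L => L (EuclideanSpace.single i (1 : ℝ))) h.fderiv
    refine Eq.trans e ?_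
    simp [EuclideanSpace.inner_single_right]
    ring
  have hh := hharm x
  unfold euclideanLaplacian at hh ⊢
  rw [Finset.sum_congr rfl (fun i _ => key i)]
  simp only [Finset.sum_add_distrib, ← Finset.mul_sum]
  rw [hh, aux_sum (fderiv ℝ p x) x, aux_euler l p hp hhom x]
  have hn : ∑ i, x i * x i = ‖x‖ ^ (2 : ℝ) := by
    rw [Real.rpow_two, EuclideanSpace.real_norm_sq_eq]
    exact Finset.sum_congr rfl fun i _ => by ring
  have h0 : 0 < ‖x‖ := norm_pos_iff.mpr hx
  have es : ∀ s : ℝ, ‖x‖ ^ (s - 2) = ‖x‖ ^ (s - 2 - 2) * ‖x‖ ^ (2 : ℝ) := fun s => by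
    rw [← Real.rpow_add h0]; congr 1; ring
  rw [hn, es s, es t]
  simp
  ring

/-- If `p` is a smooth harmonic function on `ℝⁿ` that is positively
homogeneous of degree `l`, then for all reals `a, b` the function
`w(x) = (a·‖x‖^(2-n-2l) + b·‖x‖^(4-n-2l))·p(x)` is biharmonic on `ℝⁿ∖{0}`. -/
theorem stmt_15 (n : ℕ) (hn : 5 ≤ n) (l : ℕ)
    (p : EuclideanSpace ℝ (Fin n) → ℝ) (hp : ContDiff ℝ (⊤ : ℕ∞) p)
    (hharm : ∀ x : EuclideanSpace ℝ (Fin n), euclideanLaplacian p x = 0)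
    (hhom : ∀ c : ℝ, 0 < c → ∀ x : EuclideanSpace ℝ (Fin n), p (c • x) = c^l * p x)
    (a b : ℝ) :
    ∀ x : EuclideanSpace ℝ (Fin n), x ≠ 0 →
      euclideanLaplacian
        (euclideanLaplacian (fun y : EuclideanSpace ℝ (Fin n) =>
          (a * ‖y‖ ^ ((2 : ℝ) - (n : ℝ) - 2*(l : ℝ))
            + b * ‖y‖ ^ ((4 : ℝ) - (n : ℝ) - 2*(l : ℝ))) * p y)) x
      = 0 := by
  intro x hx
  have hev : euclideanLaplacian (fun y : EuclideanSpace ℝ (Fin n) =>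
          (a * ‖y‖ ^ ((2 : ℝ) - (n : ℝ) - 2*(l : ℝ))
            + b * ‖y‖ ^ ((4 : ℝ) - (n : ℝ) - 2*(l : ℝ))) * p y) =ᶠ[nhds x]
      fun y => (0 * ‖y‖ ^ (0 : ℝ) + (b * ((4 - (n : ℝ) - 2 * l) * 2)) *
        ‖y‖ ^ ((2 : ℝ) - (n : ℝ) - 2*(l : ℝ))) * p y := by
    filter_upwards [isOpen_ne.mem_nhds hx] with y hy
    rw [aux_lap l p hp hharm hhom a b _ _ y hy]
    have : (4 : ℝ) - n - 2 * l - 2 = 2 - n - 2 * l := by ring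
    rw [this]
    ring
  have hcongr : ∀ f g : EuclideanSpace ℝ (Fin n) → ℝ, f =ᶠ[nhds x] g →
      euclideanLaplacian f x = euclideanLaplacian g x := by
    intro f g h
    unfold euclideanLaplacian
    refine Finset.sum_congr rfl fun i _ => ?_
    have h2 : (fun y => fderiv ℝ f y (EuclideanSpace.single i 1)) =ᶠ[nhds x]
        fun y => fderiv ℝ g y (EuclideanSpace.single i 1) := by
      filter_upwards [h.fderiv (𝕜 := ℝ)] with y hy
      rw [hy]
    rw [h2.fderiv_eq]
  rw [hcongr _ _ hev, aux_lap l p hp hharm hhom _ _ _ _ x hx]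
  ring
end
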